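/- arXiv:1507.07690 — 2 statements merged into one kernel-verified Lean document; each statement's English description precedes it below -/
import Mathlib

section
/- The Lipschitz-Markov property is closed under weak convergence: if P_n are Lipschitz-Markov martingale measures on ℝ^Q (Q countable) converging weakly to a martingale measure P, and the marginals are uniformly integrable, then P is Lipschitz-Markov. In particular, for a countable Q ∋ 1 and a peacock (μ_t)_{t∈Q}, the set L((μ_t)_{t∈Q}) of Lipschitz-Markov martingale measures with marginals (μ_t) is nonempty and compact. -/
open MeasureTheory Set Filter Topology

/-- The convex order on probability measures on `ℝ`. -/
def ConvexOrder (μ ν : Measure ℝ) : Prop :=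
  ∀ φ : ℝ → ℝ, ConvexOn ℝ Set.univ φ → Integrable φ μ → Integrable φ ν →
    ∫ x, φ x ∂μ ≤ ∫ x, φ x ∂ν

/-- The natural filtration of the canonical process on `ℝ^Q`. -/
noncomputable def natFiltration (Q : Type*) [Preorder Q] :
    Filtration Q (MeasurableSpace.pi : MeasurableSpace (Q → ℝ)) where
  seq i := ⨆ t ∈ Set.Iic i, MeasurableSpace.comap (fun ω : Q → ℝ => ω t) inferInstance
  mono' i j hij := by
    refine iSup_le fun t => iSup_le fun ht => ?_
    exact le_iSup₂ (f := fun (t : Q) (_ : t ∈ Set.Iic j) =>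
      MeasurableSpace.comap (fun ω : Q → ℝ => ω t) inferInstance) t (ht.trans hij)
  le' i := by
    refine iSup_le fun t => iSup_le fun _ => ?_
    exact (measurable_pi_apply t).comap_le

/-- The Lipschitz-Markov property for a measure on `ℝ^Q`. -/
def LipschitzMarkov (Q : Set ℝ) (P : Measure (↥Q → ℝ)) : Prop :=
  ∀ s t : ↥Q, s < t → ∀ f : ℝ → ℝ, LipschitzWith 1 f →
    ∃ g : ℝ → ℝ, LipschitzWith 1 g ∧
      P[(fun ω : ↥Q → ℝ => f (ω t)) | natFiltration ↥Q s] =ᵐ[P] fun ω => g (ω s)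

/-- The set `L((μ_t)_{t∈Q})` of Lipschitz-Markov martingale measures on `ℝ^Q`
with marginals `(μ_t)_{t∈Q}`. -/
def LQ (Q : Set ℝ) (μ : ↥Q → ProbabilityMeasure ℝ) :
    Set (ProbabilityMeasure (↥Q → ℝ)) :=
  {P | Martingale (fun (t : ↥Q) (ω : ↥Q → ℝ) => ω t) (natFiltration ↥Q)
        (P : Measure (↥Q → ℝ)) ∧
       LipschitzMarkov Q (P : Measure (↥Q → ℝ)) ∧
       ∀ t : ↥Q, (P : Measure (↥Q → ℝ)).map (fun ω => ω t) = (μ t : Measure ℝ)}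


open scoped BoundedContinuousFunction ENNReal NNReal

namespace LM

/-- Weak form of the conditional expectation identity `E[f(S_t) | F_s] = g(S_s)`. -/
def CE (Q : Set ℝ) (P : Measure (↥Q → ℝ)) (s t : ↥Q) (f g : ℝ → ℝ) : Prop :=
  ∀ Y : (↥(Set.Iic s) → ℝ) →ᵇ ℝ,
    ∫ ω, Y (fun i => ω i) * f (ω t) ∂P = ∫ ω, Y (fun i => ω i) * g (ω s) ∂P

lemma natFiltration_eq (Q : Set ℝ) (s : ↥Q) :
    (natFiltration ↥Q s : MeasurableSpace (↥Q → ℝ)) =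
      MeasurableSpace.comap (fun (ω : ↥Q → ℝ) (i : ↥(Set.Iic s)) => ω i) MeasurableSpace.pi := by
  change (⨆ t ∈ Set.Iic s, MeasurableSpace.comap (fun ω : ↥Q → ℝ => ω t) inferInstance) = _
  rw [MeasurableSpace.pi, MeasurableSpace.comap_iSup]
  simp only [MeasurableSpace.comap_comp]
  rw [iSup_subtype']
  rfl

lemma lip_integrable {Ω : Type*} [MeasurableSpace Ω] {P : Measure Ω} [IsProbabilityMeasure P]
    {Z : Ω → ℝ} (hZ : Integrable Z P) {f : ℝ → ℝ} (hf : LipschitzWith 1 f) :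
    Integrable (fun ω => f (Z ω)) P := by
  refine Integrable.mono' (hZ.norm.add (integrable_const |f 0|))
    (hf.continuous.comp_aestronglyMeasurable hZ.1) (Eventually.of_forall fun ω => ?_)
  have := hf.dist_le_mul (Z ω) 0
  simp only [Real.dist_eq, NNReal.coe_one, one_mul, sub_zero] at this
  simp only [Real.norm_eq_abs, Pi.add_apply]
  have h2 := abs_sub_abs_le_abs_sub (f (Z ω)) (f 0)
  linarith

lemma bcf_mul_integrable {Ω Ω' : Type*} [MeasurableSpace Ω] {P : Measure Ω}
    [TopologicalSpace Ω'] [MeasurableSpace Ω'] [BorelSpace Ω'] {Z : Ω → ℝ}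
    (hZ : Integrable Z P) (Y : Ω' →ᵇ ℝ) {r : Ω → Ω'} (hr : Measurable r) :
    Integrable (fun ω => Y (r ω) * Z ω) P :=
  hZ.bdd_mul (c := ‖Y‖) ((Y.continuous.measurable.comp hr).aestronglyMeasurable)
    (Eventually.of_forall fun _ => Y.norm_coe_le_norm _)

lemma r_meas (Q : Set ℝ) (s : ↥Q) :
    Measurable (fun (ω : ↥Q → ℝ) (i : ↥(Set.Iic s)) => ω i) := by fun_prop

lemma setIntegral_zero_of_bcf {Ω Ω' : Type*} [MeasurableSpace Ω] {P : Measure Ω}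
    [IsFiniteMeasure P]
    [TopologicalSpace Ω'] [MeasurableSpace Ω'] [BorelSpace Ω'] [HasOuterApproxClosed Ω']
    {h : Ω → ℝ} (hm : Measurable h)
    (hh : Integrable h P) {r : Ω → Ω'} (hr : Measurable r)
    (H : ∀ Y : Ω' →ᵇ ℝ, ∫ ω, Y (r ω) * h ω ∂P = 0) (E : Set Ω') (hE : MeasurableSet E) :
    ∫ ω in r ⁻¹' E, h ω ∂P = 0 := by
  let p : Ω → ℝ≥0 := fun ω => (h ω).toNNReal
  let n : Ω → ℝ≥0 := fun ω => (-h ω).toNNReal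
  have hp : Measurable p := hm.real_toNNReal
  have hn : Measurable n := hm.neg.real_toNNReal
  have hpi : Integrable (fun ω => (p ω : ℝ)) P := by
    simpa [p, Real.coe_toNNReal'] using hh.pos_part
  have hni : Integrable (fun ω => (n ω : ℝ)) P := by
    simpa [n, Real.coe_toNNReal'] using hh.neg_part
  have hpn : ∀ ω, h ω = p ω - n ω := by
    intro ω
    simp only [p, n, Real.coe_toNNReal']
    rcases le_total 0 (h ω) with h0 | h0
    · rw [max_eq_left h0, max_eq_right (by linarith)]; ring
    · rw [max_eq_right h0, max_eq_left (by linarith)]; ring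
  have f1 : IsFiniteMeasure (P.withDensity (fun ω => (p ω : ℝ≥0∞))) :=
    isFiniteMeasure_withDensity (by
      have := hpi.lintegral_lt_top
      simpa using this.ne)
  have f2 : IsFiniteMeasure (P.withDensity (fun ω => (n ω : ℝ≥0∞))) :=
    isFiniteMeasure_withDensity (by
      have := hni.lintegral_lt_top
      simpa using this.ne)
  have key : (P.withDensity (fun ω => (p ω : ℝ≥0∞))).map r =
      (P.withDensity (fun ω => (n ω : ℝ≥0∞))).map r := by
    apply ext_of_forall_integral_eq_of_IsFiniteMeasure
    intro Y
    rw [integral_map hr.aemeasurable Y.continuous.measurable.aestronglyMeasurable,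
      integral_map hr.aemeasurable Y.continuous.measurable.aestronglyMeasurable,
      integral_withDensity_eq_integral_smul hp, integral_withDensity_eq_integral_smul hn]
    have := H Y
    have e : (fun ω => Y (r ω) * h ω) = fun ω => Y (r ω) * p ω - Y (r ω) * n ω := by
      ext ω; rw [hpn]; ring
    rw [e, integral_sub (bcf_mul_integrable hpi Y hr) (bcf_mul_integrable hni Y hr)] at this
    simp only [NNReal.smul_def, smul_eq_mul]
    simp only [mul_comm (p _ : ℝ), mul_comm (n _ : ℝ)]
    linarith
  have k2 := congrArg (fun m => m E) key
  simp only [Measure.map_apply hr hE, withDensity_apply _ (hr hE)] at k2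
  simp only [hpn]
  rw [integral_sub hpi.integrableOn hni.integrableOn, sub_eq_zero,
    integral_eq_lintegral_of_nonneg_ae (Eventually.of_forall fun _ => NNReal.coe_nonneg _)
      hpi.integrableOn.1,
    integral_eq_lintegral_of_nonneg_ae (Eventually.of_forall fun _ => NNReal.coe_nonneg _)
      hni.integrableOn.1]
  simp [k2]

lemma condExp_iff_CE (Q : Set ℝ) [Countable ↥Q] (P : Measure (↥Q → ℝ)) [IsProbabilityMeasure P]
    (hi : ∀ t : ↥Q, Integrable (fun ω : ↥Q → ℝ => ω t) P) (s t : ↥Q) {f g : ℝ → ℝ}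
    (hf : LipschitzWith 1 f) (hg : LipschitzWith 1 g) :
    (P[(fun ω : ↥Q → ℝ => f (ω t)) | natFiltration ↥Q s] =ᵐ[P] fun ω => g (ω s)) ↔
      CE Q P s t f g := by
  have hfi := lip_integrable (hi t) hf
  have hgi := lip_integrable (hi s) hg
  have hle := (natFiltration ↥Q).le s
  constructor
  · intro h Y
    have hYm : StronglyMeasurable[natFiltration ↥Q s]
        (fun ω : ↥Q → ℝ => Y (fun i => ω i)) := by
      rw [natFiltration_eq]
      exact (Y.continuous.measurable.comp (comap_measurable _)).stronglyMeasurable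
    have h1 := condExp_mul_of_stronglyMeasurable_left hYm
      (bcf_mul_integrable hfi Y (r_meas Q s)) hfi
    have h2 := integral_condExp (μ := P) hle
      (f := (fun ω : ↥Q → ℝ => Y (fun i => ω i)) * fun ω => f (ω t))
    change ∫ ω, ((fun ω : ↥Q → ℝ => Y (fun i => ω i)) * fun ω : ↥Q → ℝ => f (ω t)) ω ∂P = _
    rw [← h2]
    refine integral_congr_ae ?_
    filter_upwards [h1, h] with ω h1 h
    rw [h1, Pi.mul_apply, h]
  · intro h
    symm
    refine ae_eq_condExp_of_forall_setIntegral_eq hle hfi (fun _ _ _ => hgi.integrableOn) ?_ ?_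
    · intro E hE _
      rw [natFiltration_eq] at hE
      obtain ⟨E', hE', rfl⟩ := hE
      have := setIntegral_zero_of_bcf (P := P) (h := fun ω => g (ω s) - f (ω t))
        (by have := hf.continuous.measurable; have := hg.continuous.measurable; fun_prop)
        (hgi.sub hfi) (r_meas Q s) (by
          intro Y
          simp only [mul_sub]
          rw [integral_sub (bcf_mul_integrable hgi Y (r_meas Q s))
            (bcf_mul_integrable hfi Y (r_meas Q s)), sub_eq_zero]
          exact (h Y).symm) E' hE'
      rw [integral_sub hgi.integrableOn hfi.integrableOn] at this
      linarith
    · have : StronglyMeasurable[natFiltration ↥Q s] (fun ω : ↥Q → ℝ => g (ω s)) := by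
        have h0 : Measurable[natFiltration ↥Q s] (fun ω : ↥Q → ℝ => ω s) := by
          rw [natFiltration_eq]
          exact Measurable.comp (g := fun x : (↥(Set.Iic s) → ℝ) => x ⟨s, le_refl s⟩)
            (measurable_pi_apply _) (comap_measurable _)
        exact (hg.continuous.measurable.comp h0).stronglyMeasurable
      exact this.aestronglyMeasurable

end LM

namespace LM

section conv

variable {Ω : Type*} [MeasurableSpace Ω] [TopologicalSpace Ω] [OpensMeasurableSpace Ω]
  {ι : Type*}

lemma fatou {F : Filter ι} [NeBot F] {Pn : ι → ProbabilityMeasure Ω} {P : ProbabilityMeasure Ω}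
    (hT : Tendsto Pn F (𝓝 P)) {h : Ω → ℝ} (hc : Continuous h) (h0 : ∀ ω, 0 ≤ h ω) (c : ℝ)
    (hn : ∀ᶠ n in F, Integrable h (Pn n : Measure Ω) ∧ ∫ ω, h ω ∂(Pn n : Measure Ω) ≤ c) :
    Integrable h (P : Measure Ω) ∧ ∫ ω, h ω ∂(P : Measure Ω) ≤ c := by
  have hb : ∀ N : ℕ, ∫ ω, min (h ω) N ∂(P : Measure Ω) ≤ c := by
    intro N
    let H : Ω →ᵇ ℝ := BoundedContinuousFunction.ofNormedAddCommGroup (fun ω => min (h ω) N)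
      (by fun_prop) N (fun ω => by
        rw [Real.norm_eq_abs, abs_of_nonneg (le_min (h0 ω) (Nat.cast_nonneg N))]
        exact min_le_right _ _)
    have := (ProbabilityMeasure.tendsto_iff_forall_integral_tendsto.1 hT) H
    refine le_of_tendsto this ?_
    filter_upwards [hn] with n hn
    refine le_trans (integral_mono (H.integrable _) hn.1 fun ω => ?_) hn.2
    exact min_le_left _ _
  have hIntg : ∀ N : ℕ, Integrable (fun ω => min (h ω) N) (P : Measure Ω) := by
    intro N
    refine Integrable.mono' (integrable_const (N : ℝ))
      ((hc.min continuous_const).measurable.aestronglyMeasurable)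
      (Eventually.of_forall fun ω => ?_)
    rw [Real.norm_eq_abs, abs_of_nonneg (le_min (h0 ω) (Nat.cast_nonneg N))]
    exact min_le_right _ _
  have hc0 : 0 ≤ c := by
    refine le_trans (integral_nonneg fun ω => ?_) (hb 0)
    exact le_min (h0 ω) (by simp)
  have hl : ∫⁻ ω, ENNReal.ofReal (h ω) ∂(P : Measure Ω) ≤ ENNReal.ofReal c := by
    have hsup : ∀ ω, ENNReal.ofReal (h ω) = ⨆ N : ℕ, ENNReal.ofReal (min (h ω) N) := by
      intro ω
      apply le_antisymm
      · obtain ⟨N, hN⟩ := exists_nat_ge (h ω)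
        refine le_trans ?_ (le_iSup _ N)
        rw [min_eq_left hN]
      · exact iSup_le fun N => ENNReal.ofReal_le_ofReal (min_le_left _ _)
    simp_rw [hsup]
    rw [lintegral_iSup]
    · refine iSup_le fun N => ?_
      rw [← ofReal_integral_eq_lintegral_ofReal (hIntg N)
        (Eventually.of_forall fun ω => le_min (h0 ω) (Nat.cast_nonneg N))]
      exact ENNReal.ofReal_le_ofReal (hb N)
    · intro N
      exact (hc.min continuous_const).measurable.ennreal_ofReal
    · intro N M hNM ω
      exact ENNReal.ofReal_le_ofReal (min_le_min le_rfl (by exact_mod_cast hNM))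
  have hI : Integrable h (P : Measure Ω) := by
    refine ⟨hc.measurable.aestronglyMeasurable, ?_⟩
    rw [hasFiniteIntegral_iff_ofReal (Eventually.of_forall h0)]
    exact lt_of_le_of_lt hl ENNReal.ofReal_lt_top
  refine ⟨hI, ?_⟩
  rw [← ofReal_integral_eq_lintegral_ofReal hI (Eventually.of_forall h0)] at hl
  exact (ENNReal.ofReal_le_ofReal_iff hc0).1 hl

/-- truncation -/
noncomputable def clamp (C x : ℝ) : ℝ := max (-C) (min x C)

lemma clamp_cont (C : ℝ) : Continuous (clamp C) := by unfold clamp; fun_prop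

lemma clamp_abs {C : ℝ} (hC : 0 ≤ C) (x : ℝ) : |clamp C x| ≤ C := by
  unfold clamp
  rw [abs_le]
  exact ⟨le_max_left _ _, max_le (by linarith) (min_le_right _ _)⟩

lemma clamp_sub {C : ℝ} (hC : 0 ≤ C) (x : ℝ) : |x - clamp C x| = max (|x| - C) 0 := by
  unfold clamp
  rcases le_total x C with h | h
  · rw [min_eq_left h]
    rcases le_total (-C) x with h' | h'
    · rw [max_eq_right h', sub_self, abs_zero, max_eq_right]
      have := abs_le.2 ⟨h', h⟩
      linarith
    · rw [max_eq_left h', abs_of_nonpos (by linarith), abs_of_nonpos (by linarith), max_eq_left]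
      · ring
      · linarith
  · rw [min_eq_right h, max_eq_right (by linarith), abs_of_nonneg (by linarith),
      abs_of_nonneg (by linarith), max_eq_left (by linarith)]

/-- Uniform integrability along a filter. -/
def UI (F : Filter ι) (Pn : ι → ProbabilityMeasure Ω) (Z : Ω → ℝ) : Prop :=
  (∀ᶠ n in F, Integrable Z (Pn n : Measure Ω)) ∧ ∀ ε : ℝ, 0 < ε → ∃ C : ℝ, 0 ≤ C ∧
    ∀ᶠ n in F, ∫ ω, max (|Z ω| - C) 0 ∂(Pn n : Measure Ω) ≤ ε

lemma tail_integrable {P : Measure Ω} [IsProbabilityMeasure P] {Z : Ω → ℝ} (hZ : Integrable Z P)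
    (C : ℝ) : Integrable (fun ω => max (|Z ω| - C) 0) P :=
  (hZ.abs.sub (integrable_const C)).pos_part

lemma ui_limit {F : Filter ι} [NeBot F] {Pn : ι → ProbabilityMeasure Ω} {P : ProbabilityMeasure Ω}
    (hT : Tendsto Pn F (𝓝 P)) {Z : Ω → ℝ} (hZ : Continuous Z) (hU : UI F Pn Z) :
    Integrable Z (P : Measure Ω) := by
  obtain ⟨C, hC, h⟩ := hU.2 1 one_pos
  have := fatou hT (h := fun ω => max (|Z ω| - C) 0) (by fun_prop)
    (fun _ => le_max_right _ _) 1 (by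
      filter_upwards [hU.1, h] with n h1 h2
      exact ⟨tail_integrable h1 C, h2⟩)
  refine Integrable.mono' (this.1.add (integrable_const C)) hZ.measurable.aestronglyMeasurable
    (Eventually.of_forall fun ω => ?_)
  have := le_max_left (|Z ω| - C) 0
  simp only [Real.norm_eq_abs, Pi.add_apply]
  linarith

lemma trunc_est {P : Measure Ω} [IsProbabilityMeasure P] {Z : Ω → ℝ} (hZ : Integrable Z P)
    {C : ℝ} (hC : 0 ≤ C) {f : ℝ → ℝ} (hf : LipschitzWith 1 f) (X : Ω →ᵇ ℝ) :
    |∫ ω, X ω * f (Z ω) ∂P - ∫ ω, X ω * f (clamp C (Z ω)) ∂P|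
      ≤ ‖X‖ * ∫ ω, max (|Z ω| - C) 0 ∂P := by
  have i1 : Integrable (fun ω => X ω * f (Z ω)) P :=
    (lip_integrable hZ hf).bdd_mul (c := ‖X‖) X.continuous.measurable.aestronglyMeasurable
      (Eventually.of_forall fun _ => X.norm_coe_le_norm _)
  have hcl : Integrable (fun ω => clamp C (Z ω)) P :=
    Integrable.mono' (integrable_const C) ((clamp_cont C).comp_aestronglyMeasurable hZ.1)
      (Eventually.of_forall fun ω => clamp_abs hC _)
  have i2 : Integrable (fun ω => X ω * f (clamp C (Z ω))) P :=
    (lip_integrable hcl hf).bdd_mul (c := ‖X‖) X.continuous.measurable.aestronglyMeasurable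
      (Eventually.of_forall fun _ => X.norm_coe_le_norm _)
  rw [← integral_sub i1 i2, ← integral_const_mul]
  refine (abs_integral_le_integral_abs).trans ?_
  refine integral_mono (i1.sub i2).abs ((tail_integrable hZ C).const_mul _) fun ω => ?_
  simp only
  rw [← mul_sub, abs_mul]
  refine mul_le_mul (X.norm_coe_le_norm ω) ?_ (abs_nonneg _) (norm_nonneg _)
  rw [← clamp_sub hC]
  have := hf.dist_le_mul (Z ω) (clamp C (Z ω))
  simpa [Real.dist_eq] using this

lemma conv_integral {F : Filter ι} [NeBot F] {Pn : ι → ProbabilityMeasure Ω}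
    {P : ProbabilityMeasure Ω}
    (hT : Tendsto Pn F (𝓝 P)) {Z : Ω → ℝ} (hZ : Continuous Z) (hU : UI F Pn Z)
    {f : ℝ → ℝ} (hf : LipschitzWith 1 f) (X : Ω →ᵇ ℝ) :
    Tendsto (fun n => ∫ ω, X ω * f (Z ω) ∂(Pn n : Measure Ω)) F
      (𝓝 (∫ ω, X ω * f (Z ω) ∂(P : Measure Ω))) := by
  have hZP := ui_limit hT hZ hU
  rw [Metric.tendsto_nhds]
  intro ε hε
  set K := ‖X‖ + 1 with hK
  have hKpos : 0 < K := by positivity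
  obtain ⟨C, hC, h⟩ := hU.2 (ε / (4 * K)) (by positivity)
  have hP := (fatou hT (h := fun ω => max (|Z ω| - C) 0) (by fun_prop)
    (fun _ => le_max_right _ _) (ε / (4 * K)) (by
      filter_upwards [hU.1, h] with n h1 h2
      exact ⟨tail_integrable h1 C, h2⟩)).2
  have hcf : Continuous fun ω => f (clamp C (Z ω)) :=
    hf.continuous.comp ((clamp_cont C).comp hZ)
  let G : Ω →ᵇ ℝ := BoundedContinuousFunction.ofNormedAddCommGroup (fun ω => f (clamp C (Z ω)))
    hcf (|f 0| + C) (fun ω => by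
      have h1 := hf.dist_le_mul (clamp C (Z ω)) 0
      have h2 := clamp_abs hC (Z ω)
      simp only [Real.dist_eq, NNReal.coe_one, one_mul, sub_zero] at h1
      have h3 := abs_sub_abs_le_abs_sub (f (clamp C (Z ω))) (f 0)
      rw [Real.norm_eq_abs]
      linarith)
  have ht := (ProbabilityMeasure.tendsto_iff_forall_integral_tendsto.1 hT) (X * G)
  rw [Metric.tendsto_nhds] at ht
  have hXK : ‖X‖ * (ε / (4 * K)) ≤ ε / 4 := by
    have : K * (ε / (4 * K)) = ε / 4 := by field_simp
    rw [← this]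
    exact mul_le_mul_of_nonneg_right (by linarith) (by positivity)
  filter_upwards [ht (ε / 4) (by positivity), h, hU.1] with n h1 h2 h3
  have e1 := trunc_est h3 hC hf X
  have e2 := trunc_est hZP hC hf X
  have e1' := e1.trans ((mul_le_mul_of_nonneg_left h2 (norm_nonneg _)).trans hXK)
  have e2' := e2.trans ((mul_le_mul_of_nonneg_left hP (norm_nonneg _)).trans hXK)
  rw [Real.dist_eq] at h1 ⊢
  change |∫ ω, X ω * f (clamp C (Z ω)) ∂(Pn n : Measure Ω) -
    ∫ ω, X ω * f (clamp C (Z ω)) ∂(P : Measure Ω)| < ε / 4 at h1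
  rw [abs_lt] at h1 ⊢
  rw [abs_le] at e1' e2'
  constructor <;> linarith [h1.1, h1.2, e1'.1, e1'.2, e2'.1, e2'.2]

lemma unif_conv {F : Filter ι} {gn : ι → ℝ → ℝ} {g : ℝ → ℝ}
    (hgn : ∀ᶠ n in F, LipschitzWith 1 (gn n)) (hg : LipschitzWith 1 g)
    (hlim : ∀ x, Tendsto (fun n => gn n x) F (𝓝 (g x))) (C : ℝ) {ε : ℝ} (hε : 0 < ε) :
    ∀ᶠ n in F, ∀ x, |x| ≤ C → |gn n x - g x| ≤ ε := by
  obtain ⟨T, hT, hTf, hcov⟩ := (isCompact_Icc (a := -C) (b := C)).finite_cover_balls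
    (e := ε / 3) (by positivity)
  have : ∀ᶠ n in F, ∀ y ∈ T, |gn n y - g y| < ε / 3 := by
    rw [eventually_all_finite hTf]
    intro y _
    have := (Metric.tendsto_nhds.1 (hlim y)) (ε / 3) (by positivity)
    simpa [Real.dist_eq] using this
  filter_upwards [this, hgn] with n hn hl x hx
  have hx' : x ∈ Icc (-C) C := abs_le.1 hx
  obtain ⟨y, hy, hxy⟩ := mem_iUnion₂.1 (hcov hx')
  rw [Metric.mem_ball, Real.dist_eq] at hxy
  have h1 := hl.dist_le_mul x y
  have h2 := hg.dist_le_mul x y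
  simp only [Real.dist_eq, NNReal.coe_one, one_mul] at h1 h2
  have h3 := hn y hy
  rw [abs_lt] at h3 hxy
  have h1' := abs_le.1 (h1.trans (abs_lt.2 hxy).le)
  have h2' := abs_le.1 (h2.trans (abs_lt.2 hxy).le)
  rw [abs_le]
  constructor <;> linarith [h1'.1, h1'.2, h2'.1, h2'.2, h3.1, h3.2]

lemma conv_integral_g {F : Filter ι} [NeBot F] {Pn : ι → ProbabilityMeasure Ω}
    {P : ProbabilityMeasure Ω}
    (hT : Tendsto Pn F (𝓝 P)) {Z : Ω → ℝ} (hZ : Continuous Z) (hU : UI F Pn Z)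
    {gn : ι → ℝ → ℝ} {g : ℝ → ℝ}
    (hgn : ∀ᶠ n in F, LipschitzWith 1 (gn n)) (hg : LipschitzWith 1 g)
    (hlim : ∀ x, Tendsto (fun n => gn n x) F (𝓝 (g x))) (X : Ω →ᵇ ℝ) :
    Tendsto (fun n => ∫ ω, X ω * gn n (Z ω) ∂(Pn n : Measure Ω)) F
      (𝓝 (∫ ω, X ω * g (Z ω) ∂(P : Measure Ω))) := by
  have h0 := conv_integral hT hZ hU hg X
  suffices h : Tendsto (fun n => ∫ ω, X ω * gn n (Z ω) ∂(Pn n : Measure Ω) -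
      ∫ ω, X ω * g (Z ω) ∂(Pn n : Measure Ω)) F (𝓝 0) by
    simpa using h.add h0
  rw [Metric.tendsto_nhds]
  intro ε hε
  set K := ‖X‖ + 1 with hK
  have hKpos : 0 < K := by positivity
  obtain ⟨C, hC, h⟩ := hU.2 (ε / (8 * K)) (by positivity)
  filter_upwards [h, hU.1, hgn, unif_conv hgn hg hlim C (ε := ε / (4 * K)) (by positivity)]
    with n h1 h2 h3 h4
  have i1 : Integrable (fun ω => X ω * gn n (Z ω)) (Pn n : Measure Ω) :=
    (lip_integrable h2 h3).bdd_mul (c := ‖X‖) X.continuous.measurable.aestronglyMeasurable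
      (Eventually.of_forall fun _ => X.norm_coe_le_norm _)
  have i2 : Integrable (fun ω => X ω * g (Z ω)) (Pn n : Measure Ω) :=
    (lip_integrable h2 hg).bdd_mul (c := ‖X‖) X.continuous.measurable.aestronglyMeasurable
      (Eventually.of_forall fun _ => X.norm_coe_le_norm _)
  rw [Real.dist_eq, sub_zero, ← integral_sub i1 i2]
  have hti := tail_integrable h2 C
  have : ∫ ω, |X ω * gn n (Z ω) - X ω * g (Z ω)| ∂(Pn n : Measure Ω) ≤
      ∫ ω, ‖X‖ * (ε / (4 * K) + 2 * max (|Z ω| - C) 0) ∂(Pn n : Measure Ω) := by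
    refine integral_mono (i1.sub i2).abs
      (((integrable_const _).add (hti.const_mul 2)).const_mul _) fun ω => ?_
    simp only
    rw [← mul_sub, abs_mul]
    refine mul_le_mul (X.norm_coe_le_norm ω) ?_ (abs_nonneg _) (norm_nonneg _)
    have e1 := h3.dist_le_mul (Z ω) (clamp C (Z ω))
    have e2 := hg.dist_le_mul (Z ω) (clamp C (Z ω))
    have e3 := h4 _ (clamp_abs hC (Z ω))
    simp only [Real.dist_eq, NNReal.coe_one, one_mul] at e1 e2
    rw [clamp_sub hC] at e1 e2
    rw [abs_le] at e1 e2 e3 ⊢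
    constructor <;> linarith [e1.1, e1.2, e2.1, e2.2, e3.1, e3.2]
  refine lt_of_le_of_lt (abs_integral_le_integral_abs.trans this) ?_
  rw [integral_const_mul, integral_add (integrable_const _) (hti.const_mul 2),
    integral_const_mul, integral_const]
  simp only [probReal_univ, smul_eq_mul, one_mul]
  have b1 : ε / (4 * K) + 2 * ∫ ω, max (|Z ω| - C) 0 ∂(Pn n : Measure Ω) ≤ ε / (2 * K) := by
    have : ε / (4 * K) + 2 * (ε / (8 * K)) = ε / (2 * K) := by field_simp; norm_num
    linarith
  have b2 : ‖X‖ * (ε / (2 * K)) ≤ ε / 2 := by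
    have : K * (ε / (2 * K)) = ε / 2 := by field_simp
    rw [← this]
    exact mul_le_mul_of_nonneg_right (by linarith) (by positivity)
  have := mul_le_mul_of_nonneg_left b1 (norm_nonneg X)
  linarith

lemma exists_lip_limit (U : Ultrafilter ι) {gn : ι → ℝ → ℝ}
    (hgn : ∀ᶠ n in (U : Filter ι), LipschitzWith 1 (gn n)) (M : ℝ)
    (hM : ∀ᶠ n in (U : Filter ι), |gn n 0| ≤ M) :
    ∃ g : ℝ → ℝ, LipschitzWith 1 g ∧ ∀ x, Tendsto (fun n => gn n x) U (𝓝 (g x)) := by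
  have : ∀ x, ∃ y, Tendsto (fun n => gn n x) U (𝓝 y) := by
    intro x
    have hmem : ∀ᶠ n in (U : Filter ι), gn n x ∈ Icc (-(M + |x|)) (M + |x|) := by
      filter_upwards [hgn, hM] with n h1 h2
      have := h1.dist_le_mul x 0
      simp only [Real.dist_eq, NNReal.coe_one, one_mul, sub_zero] at this
      have h3 := abs_sub_abs_le_abs_sub (gn n x) (gn n 0)
      exact abs_le.1 (by linarith)
    obtain ⟨y, _, hy⟩ := (isCompact_Icc (a := -(M + |x|)) (b := M + |x|)).ultrafilter_le_nhds
      (U.map fun n => gn n x) (le_principal_iff.2 hmem)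
    exact ⟨y, hy⟩
  choose g hg using this
  refine ⟨g, ?_, hg⟩
  refine LipschitzWith.of_dist_le_mul fun x y => ?_
  refine le_of_tendsto ((hg x).dist (hg y)) ?_
  filter_upwards [hgn] with n hn
  exact hn.dist_le_mul x y

end conv

lemma CE_limit (Q : Set ℝ) [Countable ↥Q] {ι : Type*} (U : Ultrafilter ι)
    {Pn : ι → ProbabilityMeasure (↥Q → ℝ)} {P : ProbabilityMeasure (↥Q → ℝ)}
    (hT : Tendsto Pn U (𝓝 P)) (s t : ↥Q)
    (hs : UI (U : Filter ι) Pn (fun ω : ↥Q → ℝ => ω s))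
    (ht : UI (U : Filter ι) Pn (fun ω : ↥Q → ℝ => ω t))
    {f : ℝ → ℝ} (hf : LipschitzWith 1 f) {gn : ι → ℝ → ℝ}
    (hgn : ∀ᶠ n in (U : Filter ι), LipschitzWith 1 (gn n))
    (hCE : ∀ᶠ n in (U : Filter ι), CE Q (Pn n : Measure (↥Q → ℝ)) s t f (gn n)) :
    ∃ g : ℝ → ℝ, LipschitzWith 1 g ∧ (∀ x, Tendsto (fun n => gn n x) U (𝓝 (g x))) ∧
      CE Q (P : Measure (↥Q → ℝ)) s t f g := by
  have hbd : ∀ {v : ↥Q}, UI (U : Filter ι) Pn (fun ω : ↥Q → ℝ => ω v) →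
      ∃ M : ℝ, ∀ᶠ n in (U : Filter ι), Integrable (fun ω : ↥Q → ℝ => ω v) (Pn n : Measure _) ∧
        ∫ ω : ↥Q → ℝ, |ω v| ∂(Pn n : Measure (↥Q → ℝ)) ≤ M := by
    intro v hv
    obtain ⟨C, hC, h⟩ := hv.2 1 one_pos
    refine ⟨C + 1, ?_⟩
    filter_upwards [h, hv.1] with n h1 h2
    refine ⟨h2, ?_⟩
    have hti := tail_integrable h2 C
    have : ∫ ω : ↥Q → ℝ, |ω v| ∂(Pn n : Measure (↥Q → ℝ)) ≤
        ∫ ω : ↥Q → ℝ, (C + max (|ω v| - C) 0) ∂(Pn n : Measure (↥Q → ℝ)) := by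
      refine integral_mono h2.abs ((integrable_const C).add hti) fun ω => ?_
      have := le_max_left (|ω v| - C) 0
      simp only
      linarith
    rw [integral_add (integrable_const C) hti, integral_const] at this
    simp only [probReal_univ, smul_eq_mul, one_mul] at this
    linarith
  obtain ⟨M1, hM1⟩ := hbd hs
  obtain ⟨M2, hM2⟩ := hbd ht
  obtain ⟨g, hg, hlim⟩ := exists_lip_limit U hgn (M1 + (|f 0| + M2)) (by
    filter_upwards [hgn, hCE, hM1, hM2] with n h1 h2 h3 h4
    have e := h2 (BoundedContinuousFunction.const _ 1)
    simp only [BoundedContinuousFunction.const_apply, one_mul] at e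
    have i1 := lip_integrable h3.1 h1
    have i2 := lip_integrable h4.1 hf
    have a1 : |gn n 0 - ∫ ω : ↥Q → ℝ, gn n (ω s) ∂(Pn n : Measure (↥Q → ℝ))| ≤ M1 := by
      have : gn n 0 = ∫ ω : ↥Q → ℝ, gn n 0 ∂(Pn n : Measure (↥Q → ℝ)) := by simp
      rw [this, ← integral_sub (integrable_const _) i1]
      refine abs_integral_le_integral_abs.trans (le_trans ?_ h3.2)
      refine integral_mono ((integrable_const _).sub i1).abs h3.1.abs fun ω => ?_
      have := h1.dist_le_mul 0 (ω s)
      simpa [Real.dist_eq] using this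
    have a2 : |∫ ω : ↥Q → ℝ, f (ω t) ∂(Pn n : Measure (↥Q → ℝ))| ≤ |f 0| + M2 := by
      refine abs_integral_le_integral_abs.trans ?_
      have : ∫ ω : ↥Q → ℝ, |f (ω t)| ∂(Pn n : Measure (↥Q → ℝ)) ≤
          ∫ ω : ↥Q → ℝ, (|f 0| + |ω t|) ∂(Pn n : Measure (↥Q → ℝ)) := by
        refine integral_mono i2.abs ((integrable_const _).add h4.1.abs) fun ω => ?_
        have := hf.dist_le_mul (ω t) 0
        simp only [Real.dist_eq, NNReal.coe_one, one_mul, sub_zero] at this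
        have h3 := abs_sub_abs_le_abs_sub (f (ω t)) (f 0)
        simp only
        linarith
      rw [integral_add (integrable_const _) h4.1.abs, integral_const] at this
      simp only [probReal_univ, smul_eq_mul, one_mul] at this
      linarith [h4.2]
    rw [e] at a2
    rw [abs_le] at a1 a2 ⊢
    constructor <;> linarith [a1.1, a1.2, a2.1, a2.2])
  refine ⟨g, hg, hlim, fun Y => ?_⟩
  let X : (↥Q → ℝ) →ᵇ ℝ := Y.compContinuous ⟨fun ω i => ω i, by fun_prop⟩
  have c1 := conv_integral hT (continuous_apply t) ht hf X
  have c2 := conv_integral_g hT (continuous_apply s) hs hgn hg hlim X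
  refine tendsto_nhds_unique c1 (c2.congr' ?_)
  filter_upwards [hCE] with n hn
  exact (hn Y).symm

end LM

namespace LM

lemma tail_small (ν : Measure ℝ) [IsProbabilityMeasure ν] (hν : Integrable (fun x => |x|) ν)
    {ε : ℝ} (hε : 0 < ε) : ∃ C : ℝ, 0 ≤ C ∧ ∫ x, max (|x| - C) 0 ∂ν ≤ ε := by
  have h : Tendsto (fun n : ℕ => ∫ x, max (|x| - n) 0 ∂ν) atTop (𝓝 (∫ _, (0 : ℝ) ∂ν)) := by
    refine tendsto_integral_of_dominated_convergence (fun x => |x|) ?_ hν ?_ ?_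
    · intro n
      exact Continuous.aestronglyMeasurable (by fun_prop)
    · intro n
      refine Eventually.of_forall fun x => ?_
      rw [Real.norm_eq_abs, abs_of_nonneg (le_max_right _ _)]
      have : (0 : ℝ) ≤ n := Nat.cast_nonneg n
      exact max_le (by linarith) (abs_nonneg x)
    · refine Eventually.of_forall fun x => ?_
      refine tendsto_const_nhds.congr' ?_
      obtain ⟨N, hN⟩ := exists_nat_ge |x|
      filter_upwards [eventually_ge_atTop N] with n hn
      have : (N : ℝ) ≤ n := by exact_mod_cast hn
      rw [max_eq_right (by linarith)]
  rw [integral_zero] at h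
  obtain ⟨n, hn⟩ := (h.eventually (eventually_le_nhds hε)).exists
  exact ⟨n, Nat.cast_nonneg n, hn⟩

lemma tail_eq {C : ℝ} (hC : 0 ≤ C) (x : ℝ) :
    max (|x| - C) 0 = (|x - C| + |x - (-C)|) / 2 - C := by
  rcases le_total |x| C with h | h
  · rw [max_eq_right (by linarith)]
    rw [abs_le] at h
    rw [abs_of_nonpos (by linarith), abs_of_nonneg (by linarith)]
    ring
  · rw [max_eq_left (by linarith)]
    rcases le_total 0 x with h0 | h0
    · rw [abs_of_nonneg h0] at *
      rw [abs_of_nonneg (by linarith), abs_of_nonneg (by linarith)]; ring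
    · rw [abs_of_nonpos h0] at *
      rw [abs_of_nonpos (by linarith), abs_of_nonpos (by linarith)]; ring

lemma lip_abs (k : ℝ) : LipschitzWith 1 (fun x : ℝ => |x - k|) := by
  refine LipschitzWith.of_dist_le_mul fun x y => ?_
  simp only [Real.dist_eq, NNReal.coe_one, one_mul]
  have := abs_abs_sub_abs_le_abs_sub (x - k) (y - k)
  simpa using this

lemma tail_le {Ω : Type*} [MeasurableSpace Ω] {P : Measure Ω} [IsProbabilityMeasure P]
    {Z : Ω → ℝ} (hZ : Integrable Z P) {ν : Measure ℝ} [IsProbabilityMeasure ν]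
    (hν : Integrable (fun x : ℝ => x) ν)
    (h : ∀ k, ∫ ω, |Z ω - k| ∂P ≤ ∫ x, |x - k| ∂ν) {C : ℝ} (hC : 0 ≤ C) :
    ∫ ω, max (|Z ω| - C) 0 ∂P ≤ ∫ x, max (|x| - C) 0 ∂ν := by
  simp only [tail_eq hC]
  have i1 := fun k => lip_integrable hZ (lip_abs k)
  have i2 := fun k => lip_integrable hν (lip_abs k)
  have j1 : Integrable (fun ω => (|Z ω - C| + |Z ω - -C|) / 2) P :=
    ((i1 C).add (i1 (-C))).div_const 2
  have j2 : Integrable (fun x => (|x - C| + |x - -C|) / 2) ν :=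
    ((i2 C).add (i2 (-C))).div_const 2
  rw [integral_sub j1 (integrable_const C), integral_sub j2 (integrable_const C),
    integral_div, integral_div, integral_add (i1 C) (i1 (-C)), integral_add (i2 C) (i2 (-C))]
  simp only [integral_const, probReal_univ]
  linarith [h C, h (-C)]

/-- Lipschitz-Markov martingale measures whose marginals have potentials below those of `μ`. -/
def SS (Q : Set ℝ) (μ : ↥Q → ProbabilityMeasure ℝ) : Set (ProbabilityMeasure (↥Q → ℝ)) :=
  {P | (∀ t : ↥Q, Integrable (fun ω : ↥Q → ℝ => ω t) (P : Measure (↥Q → ℝ))) ∧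
    (∀ s t : ↥Q, s < t → CE Q (P : Measure (↥Q → ℝ)) s t (fun x => x) (fun x => x)) ∧
    (∀ s t : ↥Q, s < t → ∀ f : ℝ → ℝ, LipschitzWith 1 f → ∃ g : ℝ → ℝ, LipschitzWith 1 g ∧
      CE Q (P : Measure (↥Q → ℝ)) s t f g) ∧
    ∀ (t : ↥Q) (k : ℝ), ∫ ω : ↥Q → ℝ, |ω t - k| ∂(P : Measure (↥Q → ℝ)) ≤
      ∫ x, |x - k| ∂(μ t : Measure ℝ)}

lemma lip_id : LipschitzWith 1 (fun x : ℝ => x) := LipschitzWith.id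

lemma LM_iff (Q : Set ℝ) [Countable ↥Q] (P : Measure (↥Q → ℝ)) [IsProbabilityMeasure P]
    (hi : ∀ t : ↥Q, Integrable (fun ω : ↥Q → ℝ => ω t) P) :
    LipschitzMarkov Q P ↔ ∀ s t : ↥Q, s < t → ∀ f : ℝ → ℝ, LipschitzWith 1 f →
      ∃ g : ℝ → ℝ, LipschitzWith 1 g ∧ CE Q P s t f g := by
  unfold LipschitzMarkov
  refine forall_congr' fun s => forall_congr' fun t => forall_congr' fun _ =>
    forall_congr' fun f => forall_congr' fun hf => exists_congr fun g => ?_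
  exact and_congr_right fun hg => condExp_iff_CE Q P hi s t hf hg

lemma mart_iff (Q : Set ℝ) [Countable ↥Q] (P : Measure (↥Q → ℝ)) [IsProbabilityMeasure P] :
    Martingale (fun (t : ↥Q) (ω : ↥Q → ℝ) => ω t) (natFiltration ↥Q) P ↔
      (∀ t : ↥Q, Integrable (fun ω : ↥Q → ℝ => ω t) P) ∧
      (∀ s t : ↥Q, s < t → CE Q P s t (fun x => x) (fun x => x)) := by
  constructor
  · intro h
    have hi := fun t => h.integrable t
    exact ⟨hi, fun s t hst => (condExp_iff_CE Q P hi s t lip_id lip_id).1 (h.2 s t hst.le)⟩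
  · rintro ⟨hi, h⟩
    have had : StronglyAdapted (natFiltration ↥Q) (fun (t : ↥Q) (ω : ↥Q → ℝ) => ω t) := by
      intro s
      have h0 : Measurable[natFiltration ↥Q s] (fun ω : ↥Q → ℝ => ω s) := by
        rw [natFiltration_eq]
        exact Measurable.comp (g := fun x : (↥(Set.Iic s) → ℝ) => x ⟨s, le_refl s⟩)
            (measurable_pi_apply _) (comap_measurable _)
      exact h0.stronglyMeasurable
    refine ⟨had, fun s t hst => ?_⟩
    rcases hst.eq_or_lt with rfl | hlt
    · rw [condExp_of_stronglyMeasurable ((natFiltration ↥Q).le s) (had s) (hi s)]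
    · exact (condExp_iff_CE Q P hi s t lip_id lip_id).2 (h s t hlt)

/-- Closedness of the Lipschitz-Markov property. -/
lemma part_one (Q : Set ℝ) [Countable ↥Q]
    (Pn : ℕ → ProbabilityMeasure (↥Q → ℝ)) (P : ProbabilityMeasure (↥Q → ℝ))
    (hM : ∀ n, Martingale (fun (t : ↥Q) (ω : ↥Q → ℝ) => ω t) (natFiltration ↥Q)
        (Pn n : Measure (↥Q → ℝ)))
    (hL : ∀ n, LipschitzMarkov Q (Pn n : Measure (↥Q → ℝ)))
    (hP : Martingale (fun (t : ↥Q) (ω : ↥Q → ℝ) => ω t) (natFiltration ↥Q)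
        (P : Measure (↥Q → ℝ)))
    (hT : Tendsto Pn atTop (𝓝 P))
    (hUI : ∀ ε : ℝ, 0 < ε → ∃ C : ℝ, ∀ n (t : ↥Q),
        ∫ ω in {ω : ↥Q → ℝ | C ≤ |ω t|}, |ω t| ∂(Pn n : Measure (↥Q → ℝ)) ≤ ε) :
    LipschitzMarkov Q (P : Measure (↥Q → ℝ)) := by
  have hi := fun n => ((mart_iff Q _).1 (hM n)).1
  rw [LM_iff Q _ ((mart_iff Q _).1 hP).1]
  intro s t hst f hf
  let U : Ultrafilter ℕ := Ultrafilter.of atTop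
  have hU : ∀ v : ↥Q, UI (U : Filter ℕ) Pn (fun ω : ↥Q → ℝ => ω v) := by
    intro v
    refine ⟨Eventually.of_forall fun n => hi n v, fun ε hε => ?_⟩
    obtain ⟨C, hC⟩ := hUI ε hε
    refine ⟨max C 0, le_max_right _ _, Eventually.of_forall fun n => le_trans ?_ (hC n v)⟩
    have hms : MeasurableSet {ω : ↥Q → ℝ | C ≤ |ω v|} :=
      measurableSet_le measurable_const (by fun_prop)
    rw [← integral_indicator hms]
    refine integral_mono (tail_integrable (hi n v) _) ((hi n v).abs.indicator hms) fun ω => ?_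
    simp only [indicator, mem_ofPred_eq]
    split_ifs with h
    · exact max_le (by linarith [le_max_right C 0, abs_nonneg (ω v)]) (abs_nonneg _)
    · rw [max_eq_right]
      linarith [le_max_left C 0]
  have := fun n => (LM_iff Q _ (hi n)).1 (hL n) s t hst f hf
  choose gn hgn hCE using this
  obtain ⟨g, hg, _, h⟩ := CE_limit Q U (hT.mono_left (Ultrafilter.of_le _)) s t (hU s) (hU t) hf
    (Eventually.of_forall hgn) (Eventually.of_forall hCE)
  exact ⟨g, hg, h⟩

lemma SS_UI (Q : Set ℝ) (μ : ↥Q → ProbabilityMeasure ℝ)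
    (hmom : ∀ t, Integrable (fun x => |x|) (μ t : Measure ℝ))
    (U : Ultrafilter (ProbabilityMeasure (↥Q → ℝ))) (hU : SS Q μ ∈ U) (v : ↥Q) :
    UI (U : Filter _) id (fun ω : ↥Q → ℝ => ω v) := by
  refine ⟨?_, fun ε hε => ?_⟩
  · filter_upwards [hU] with P hP using hP.1 v
  · obtain ⟨C, hC, h⟩ := tail_small _ (hmom v) hε
    refine ⟨C, hC, ?_⟩
    filter_upwards [hU] with P hP
    exact (tail_le (hP.1 v) ((integrable_norm_iff (by fun_prop)).1 (hmom v)) (hP.2.2.2 v) hC).trans h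

lemma SS_closed (Q : Set ℝ) [Countable ↥Q] (μ : ↥Q → ProbabilityMeasure ℝ)
    (hmom : ∀ t, Integrable (fun x => |x|) (μ t : Measure ℝ)) : IsClosed (SS Q μ) := by
  rw [isClosed_iff_ultrafilter]
  intro P U hUP hU
  have hui := SS_UI Q μ hmom U hU
  have hT : Tendsto id (U : Filter _) (𝓝 P) := hUP
  refine ⟨fun t => ui_limit hT (continuous_apply t) (hui t), ?_, ?_, ?_⟩
  · intro s t hst
    obtain ⟨g, hg, hlim, h⟩ := CE_limit Q U hT s t (hui s) (hui t) lip_id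
      (gn := fun _ x => x) (Eventually.of_forall fun _ => lip_id) (by
        filter_upwards [hU] with P hP using hP.2.1 s t hst)
    have : g = fun x => x := by
      ext x
      exact tendsto_nhds_unique (hlim x) tendsto_const_nhds
    rwa [this] at h
  · intro s t hst f hf
    have : ∀ P : ProbabilityMeasure (↥Q → ℝ), ∃ g : ℝ → ℝ, P ∈ SS Q μ →
        LipschitzWith 1 g ∧ CE Q (P : Measure (↥Q → ℝ)) s t f g := by
      intro P
      by_cases hP : P ∈ SS Q μ
      · obtain ⟨g, hg⟩ := hP.2.2.1 s t hst f hf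
        exact ⟨g, fun _ => hg⟩
      · exact ⟨0, fun h => absurd h hP⟩
    choose gn hgn using this
    obtain ⟨g, hg, hlim, h⟩ := CE_limit Q U hT s t (hui s) (hui t) hf
      (gn := gn) (by filter_upwards [hU] with P hP using (hgn P hP).1) (by
        filter_upwards [hU] with P hP using (hgn P hP).2)
    exact ⟨g, hg, h⟩
  · intro t k
    refine (fatou hT (h := fun ω : ↥Q → ℝ => |ω t - k|) (by fun_prop)
      (fun _ => abs_nonneg _) _ ?_).2
    filter_upwards [hU] with P hP
    exact ⟨lip_integrable (hP.1 t) (lip_abs k), hP.2.2.2 t k⟩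

lemma T_closed (Q : Set ℝ) [Countable ↥Q] (μ : ↥Q → ProbabilityMeasure ℝ)
    (hmom : ∀ t, Integrable (fun x => |x|) (μ t : Measure ℝ)) (t : ↥Q) (k : ℝ) :
    IsClosed (SS Q μ ∩ {P | ∫ x, |x - k| ∂(μ t : Measure ℝ) ≤
      ∫ ω : ↥Q → ℝ, |ω t - k| ∂(P : Measure (↥Q → ℝ))}) := by
  rw [isClosed_iff_ultrafilter]
  intro P U hUP hU
  have hU1 : SS Q μ ∈ U := Filter.mem_of_superset hU inter_subset_left
  refine ⟨isClosed_iff_ultrafilter.1 (SS_closed Q μ hmom) P U hUP hU1, ?_⟩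
  have hui := SS_UI Q μ hmom U hU1
  have hT : Tendsto id (U : Filter _) (𝓝 P) := hUP
  have := conv_integral hT (continuous_apply t) (hui t) (lip_abs k)
    (BoundedContinuousFunction.const _ 1)
  simp only [BoundedContinuousFunction.const_apply, one_mul] at this
  refine ge_of_tendsto this ?_
  filter_upwards [hU] with P hP using hP.2

lemma SS_compact (Q : Set ℝ) [Countable ↥Q] (μ : ↥Q → ProbabilityMeasure ℝ)
    (hmom : ∀ t, Integrable (fun x => |x|) (μ t : Measure ℝ)) : IsCompact (SS Q μ) := by
  rw [← (SS_closed Q μ hmom).closure_eq]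
  apply isCompact_closure_of_isTightMeasureSet
  rw [isTightMeasureSet_iff_exists_isCompact_measure_compl_le]
  intro ε hε
  obtain ⟨ε', hε', hsum⟩ := ENNReal.exists_pos_sum_of_countable' hε.ne' ↥Q
  have hR : ∀ t : ↥Q, ∃ R : ℝ, ∀ P ∈ SS Q μ,
      (P : Measure (↥Q → ℝ)) {ω | ω t ∈ Icc (-R) R}ᶜ ≤ ε' t := by
    intro t
    by_cases htop : ε' t = ∞
    · exact ⟨0, fun P _ => by rw [htop]; exact le_top⟩
    set M := ∫ x, |x - 0| ∂(μ t : Measure ℝ)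
    have hM0 : 0 ≤ M := integral_nonneg fun _ => abs_nonneg _
    have hpos : 0 < (ε' t).toReal := ENNReal.toReal_pos (hε' t).ne' htop
    refine ⟨(M + 1) / (ε' t).toReal, fun P hP => ?_⟩
    set R := (M + 1) / (ε' t).toReal
    have hRpos : 0 < R := by positivity
    have h1 := mul_meas_ge_le_integral_of_nonneg (μ := (P : Measure (↥Q → ℝ)))
      (f := fun ω : ↥Q → ℝ => |ω t - 0|) (Eventually.of_forall fun _ => abs_nonneg _)
      (lip_integrable (hP.1 t) (lip_abs 0)) R
    have h2 := h1.trans (hP.2.2.2 t 0)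
    have h3 : (P : Measure (↥Q → ℝ)).real {ω | R ≤ |ω t - 0|} ≤ (ε' t).toReal := by
      have : R * (ε' t).toReal = M + 1 := by simp only [R]; field_simp
      by_contra hcon
      push Not at hcon
      have := mul_lt_mul_of_pos_left hcon hRpos
      linarith
    have h4 : (P : Measure (↥Q → ℝ)) {ω | R ≤ |ω t - 0|} ≤ ε' t := by
      rw [Measure.real] at h3
      exact (ENNReal.toReal_le_toReal (measure_ne_top _ _) htop).1 h3
    refine (measure_mono ?_).trans h4
    intro ω hω
    simp only [mem_compl_iff, mem_ofPred_eq, mem_Icc, ← abs_le] at hω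
    simp only [mem_ofPred_eq, sub_zero]
    linarith
  choose R hR using hR
  refine ⟨Set.pi univ fun t => Icc (-R t) (R t), isCompact_univ_pi fun t => isCompact_Icc, ?_⟩
  rintro _ ⟨P, hP, rfl⟩
  have : (Set.pi univ fun t : ↥Q => Icc (-R t) (R t))ᶜ ⊆
      ⋃ t : ↥Q, {ω : ↥Q → ℝ | ω t ∈ Icc (-R t) (R t)}ᶜ := by
    intro ω hω
    simp only [mem_compl_iff, Set.mem_pi, mem_univ, true_imp_iff, not_forall] at hω
    obtain ⟨t, ht⟩ := hω
    exact mem_iUnion.2 ⟨t, ht⟩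
  refine (measure_mono this).trans ((measure_iUnion_le _).trans ?_)
  exact (ENNReal.tsum_le_tsum fun t => hR t P hP).trans hsum.le

lemma measure_eq_of_pot (η ν : Measure ℝ) [IsProbabilityMeasure η] [IsProbabilityMeasure ν]
    (hη : Integrable (fun x : ℝ => x) η) (hν : Integrable (fun x : ℝ => x) ν)
    (h : ∀ k, ∫ x, |x - k| ∂η = ∫ x, |x - k| ∂ν) : η = ν := by
  have key : ∀ (m : Measure ℝ) [IsProbabilityMeasure m], Integrable (fun x : ℝ => x) m → ∀ k : ℝ,
      Tendsto (fun n : ℕ => ((n : ℝ) + 1) * (∫ x, |x - (k + 1 / ((n : ℝ) + 1))| ∂m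
        - ∫ x, |x - k| ∂m)) atTop (𝓝 (2 * m.real (Iic k) - 1)) := by
    intro m _ hm k
    have hlim : Tendsto (fun n : ℕ => ∫ x, ((n : ℝ) + 1) *
        (|x - (k + 1 / ((n : ℝ) + 1))| - |x - k|) ∂m) atTop
        (𝓝 (∫ x, (2 * (Iic k).indicator 1 x - 1) ∂m)) := by
      refine tendsto_integral_of_dominated_convergence (fun _ => (1 : ℝ)) ?_
        (integrable_const _) ?_ ?_
      · intro n
        exact Continuous.aestronglyMeasurable (by fun_prop)
      · intro n
        refine Eventually.of_forall fun x => ?_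
        have hn : (0 : ℝ) < (n : ℝ) + 1 := by positivity
        have := abs_abs_sub_abs_le_abs_sub (x - (k + 1 / ((n : ℝ) + 1))) (x - k)
        rw [Real.norm_eq_abs, abs_mul, abs_of_pos hn]
        have e : |x - (k + 1 / ((n : ℝ) + 1)) - (x - k)| = 1 / ((n : ℝ) + 1) := by
          rw [show x - (k + 1 / ((n : ℝ) + 1)) - (x - k) = -(1 / ((n : ℝ) + 1)) by ring,
            abs_neg, abs_of_pos (by positivity)]
        rw [e] at this
        calc _ ≤ ((n : ℝ) + 1) * (1 / ((n : ℝ) + 1)) := mul_le_mul_of_nonneg_left this hn.le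
          _ = 1 := by field_simp
      · refine Eventually.of_forall fun x => ?_
        refine tendsto_const_nhds.congr' ?_
        rcases le_or_gt x k with hx | hx
        · refine Eventually.of_forall fun n => ?_
          have hn : (0 : ℝ) < (n : ℝ) + 1 := by positivity
          have hn' : 0 < 1 / ((n : ℝ) + 1) := by positivity
          rw [indicator_of_mem (by exact hx)]
          beta_reduce
          rw [abs_of_nonpos (show x - (k + 1 / ((n : ℝ) + 1)) ≤ 0 by linarith),
            abs_of_nonpos (show x - k ≤ 0 by linarith)]
          simp only [Pi.one_apply]
          field_simp
          ring
        · obtain ⟨N, hN⟩ := exists_nat_one_div_lt (sub_pos.2 hx)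
          filter_upwards [eventually_ge_atTop N] with n hn
          have h1 : 1 / ((n : ℝ) + 1) ≤ 1 / ((N : ℝ) + 1) :=
            one_div_le_one_div_of_le (by positivity) (by
              have : (N : ℝ) ≤ n := by exact_mod_cast hn
              linarith)
          have hn : (0 : ℝ) < (n : ℝ) + 1 := by positivity
          rw [indicator_of_notMem (by simpa using hx)]
          rw [abs_of_nonneg (show 0 ≤ x - (k + 1 / ((n : ℝ) + 1)) by linarith),
            abs_of_nonneg (show 0 ≤ x - k by linarith)]
          field_simp
          ring
    have e1 : ∫ x, (2 * (Iic k).indicator (1 : ℝ → ℝ) x - 1) ∂m = 2 * m.real (Iic k) - 1 := by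
      have j : Integrable (fun x => 2 * (Iic k).indicator (1 : ℝ → ℝ) x) m :=
        ((integrable_const (1 : ℝ)).indicator measurableSet_Iic).const_mul 2
      rw [integral_sub j (integrable_const _), integral_const_mul, integral_indicator_one measurableSet_Iic]
      simp
    rw [e1] at hlim
    refine hlim.congr fun n => ?_
    rw [integral_const_mul, integral_sub (lip_integrable hm (lip_abs _))
      (lip_integrable hm (lip_abs _))]
  refine Measure.ext_of_Iic η ν fun k => ?_
  have l1 := key η hη k
  simp only [h] at l1
  have := tendsto_nhds_unique l1 (key ν hν k)
  have h3 : η.real (Iic k) = ν.real (Iic k) := by linarith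
  exact (measureReal_eq_measureReal_iff).1 h3

lemma LQ_eq (Q : Set ℝ) [Countable ↥Q] (μ : ↥Q → ProbabilityMeasure ℝ)
    (hmom : ∀ t, Integrable (fun x => |x|) (μ t : Measure ℝ)) :
    LQ Q μ = SS Q μ ∩ ⋂ i : ↥Q × ℝ, (SS Q μ ∩ {P | ∫ x, |x - i.2| ∂(μ i.1 : Measure ℝ) ≤
      ∫ ω : ↥Q → ℝ, |ω i.1 - i.2| ∂(P : Measure (↥Q → ℝ))}) := by
  have hIntg : ∀ t, Integrable (fun x : ℝ => x) (μ t : Measure ℝ) :=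
    fun t => (integrable_norm_iff (by fun_prop)).1 (hmom t)
  have hpot : ∀ (P : ProbabilityMeasure (↥Q → ℝ)) (t : ↥Q) (k : ℝ),
      ∫ x, |x - k| ∂((P : Measure (↥Q → ℝ)).map (fun ω => ω t)) =
      ∫ ω : ↥Q → ℝ, |ω t - k| ∂(P : Measure (↥Q → ℝ)) := fun P t k =>
    integral_map (measurable_pi_apply t).aemeasurable
      (Continuous.aestronglyMeasurable (by fun_prop))
  ext P
  constructor
  · rintro ⟨hM, hL, hmarg⟩
    obtain ⟨hi, hce⟩ := (mart_iff Q _).1 hM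
    have hSS : P ∈ SS Q μ := by
      refine ⟨hi, hce, (LM_iff Q _ hi).1 hL, fun t k => ?_⟩
      rw [← hpot, hmarg]
    refine ⟨hSS, mem_iInter.2 fun i => ⟨hSS, ?_⟩⟩
    simp only [mem_ofPred_eq]
    rw [← hpot, hmarg]
  · rintro ⟨hSS, hT⟩
    refine ⟨(mart_iff Q _).2 ⟨hSS.1, hSS.2.1⟩, (LM_iff Q _ hSS.1).2 hSS.2.2.1, fun t => ?_⟩
    have : IsProbabilityMeasure ((P : Measure (↥Q → ℝ)).map (fun ω => ω t)) :=
      Measure.isProbabilityMeasure_map (measurable_pi_apply t).aemeasurable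
    refine measure_eq_of_pot _ _ ?_ (hIntg t) fun k => ?_
    · exact (integrable_map_measure (g := fun x : ℝ => x) measurable_id.aestronglyMeasurable
        (measurable_pi_apply t).aemeasurable).2 (hSS.1 t)
    · rw [hpot]
      exact le_antisymm (hSS.2.2.2 t k) (mem_iInter.1 hT (t, k)).2

end LM

namespace LM

/-! ### Choosing the interval -/

lemma exists_zero_right {D : ℝ → ℝ} (hc : Continuous D)
    (hconv : ∀ x y, D ((x + y) / 2) ≤ (D x + D y) / 2) {k : ℝ} (hk : D k < 0)
    (hlim : ∀ δ : ℝ, 0 < δ → ∃ x, k < x ∧ -δ < D x) : ∃ b, k < b ∧ D b = 0 := by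
  have : ∃ x, k < x ∧ 0 ≤ D x := by
    by_contra hcon
    push Not at hcon
    obtain ⟨x, hx, hDx⟩ := hlim (-D k / 2) (by linarith)
    have h1 := hconv k (2 * x - k)
    have h2 := hcon (2 * x - k) (by linarith)
    rw [show (k + (2 * x - k)) / 2 = x by ring] at h1
    linarith
  obtain ⟨x, hx, hDx⟩ := this
  obtain ⟨b, hb, hDb⟩ := intermediate_value_Icc hx.le hc.continuousOn ⟨hk.le, hDx⟩
  refine ⟨b, lt_of_le_of_ne hb.1 ?_, hDb⟩
  rintro rfl
  linarith

lemma pot_atTop (m : Measure ℝ) [IsProbabilityMeasure m] (hm : Integrable (fun x : ℝ => x) m) :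
    Tendsto (fun x => ∫ y, |y - x| ∂m - x) atTop (𝓝 (-∫ y, y ∂m)) := by
  have h : Tendsto (fun x : ℝ => ∫ y, (|y - x| - x) ∂m) atTop (𝓝 (∫ y, -y ∂m)) := by
    refine tendsto_integral_filter_of_dominated_convergence (fun y => |y|) ?_ ?_ hm.abs ?_
    · exact Eventually.of_forall fun x => Continuous.aestronglyMeasurable (by fun_prop)
    · filter_upwards [eventually_ge_atTop 0] with x hx
      refine Eventually.of_forall fun y => ?_
      have := abs_abs_sub_abs_le_abs_sub (y - x) (-x)
      rw [abs_neg, abs_of_nonneg hx] at this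
      simpa using this
    · refine Eventually.of_forall fun y => ?_
      refine tendsto_const_nhds.congr' ?_
      filter_upwards [eventually_ge_atTop y] with x hx
      rw [abs_of_nonpos (by linarith)]
      ring
  rw [integral_neg] at h
  refine h.congr fun x => ?_
  rw [integral_sub (lip_integrable hm (lip_abs x)) (integrable_const x)]
  simp

lemma pot_atBot (m : Measure ℝ) [IsProbabilityMeasure m] (hm : Integrable (fun x : ℝ => x) m) :
    Tendsto (fun x => ∫ y, |y - (-x)| ∂m - x) atTop (𝓝 (∫ y, y ∂m)) := by
  have h : Tendsto (fun x : ℝ => ∫ y, (|y - (-x)| - x) ∂m) atTop (𝓝 (∫ y, y ∂m)) := by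
    refine tendsto_integral_filter_of_dominated_convergence (fun y => |y|) ?_ ?_ hm.abs ?_
    · exact Eventually.of_forall fun x => Continuous.aestronglyMeasurable (by fun_prop)
    · filter_upwards [eventually_ge_atTop 0] with x hx
      refine Eventually.of_forall fun y => ?_
      have := abs_abs_sub_abs_le_abs_sub (y - (-x)) x
      rw [abs_of_nonneg hx] at this
      simpa using this
    · refine Eventually.of_forall fun y => ?_
      refine tendsto_const_nhds.congr' ?_
      filter_upwards [eventually_ge_atTop (-y)] with x hx
      rw [abs_of_nonneg (by linarith)]
      ring
  refine h.congr fun x => ?_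
  rw [integral_sub (lip_integrable hm (lip_abs _)) (integrable_const x)]
  simp

lemma lip_pot (m : Measure ℝ) [IsProbabilityMeasure m] (hm : Integrable (fun x : ℝ => x) m) :
    LipschitzWith 1 (fun k => ∫ y, |y - k| ∂m) := by
  refine LipschitzWith.of_dist_le_mul fun x y => ?_
  simp only [Real.dist_eq, NNReal.coe_one, one_mul]
  rw [← integral_sub (lip_integrable hm (lip_abs _)) (lip_integrable hm (lip_abs _))]
  refine abs_integral_le_integral_abs.trans ?_
  have : ∫ z, |(|z - x| - |z - y|)| ∂m ≤ ∫ _, |x - y| ∂m := by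
    refine integral_mono ((lip_integrable hm (lip_abs _)).sub
      (lip_integrable hm (lip_abs _))).abs (integrable_const _) fun z => ?_
    have := abs_abs_sub_abs_le_abs_sub (z - x) (z - y)
    rw [show z - x - (z - y) = -(x - y) by ring, abs_neg] at this
    exact this
  simpa using this

lemma exists_interval (η ν : Measure ℝ) [IsProbabilityMeasure η] [IsProbabilityMeasure ν]
    (hη : Integrable (fun x : ℝ => x) η) (hν : Integrable (fun x : ℝ => x) ν)
    (h : ∀ k, ∫ x, |x - k| ∂η ≤ ∫ x, |x - k| ∂ν) (k : ℝ)
    (hk : ∫ x, |x - k| ∂η < ∫ x, |x - k| ∂ν) :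
    ∃ a b c : ℝ, a < k ∧ k < b ∧
      (∀ x, ∫ y, |y - k| ∂ν + c * (x - k) ≤ ∫ y, |y - x| ∂ν) ∧
      ∫ y, |y - a| ∂η = ∫ y, |y - k| ∂ν + c * (a - k) ∧
      ∫ y, |y - b| ∂η = ∫ y, |y - k| ∂ν + c * (b - k) := by
  have m1 : -∫ y, y ∂η ≤ -∫ y, y ∂ν :=
    le_of_tendsto_of_tendsto' (pot_atTop η hη) (pot_atTop ν hν) fun x => by linarith [h x]
  have m2 : ∫ y, y ∂η ≤ ∫ y, y ∂ν :=
    le_of_tendsto_of_tendsto' (pot_atBot η hη) (pot_atBot ν hν) fun x => by linarith [h (-x)]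
  have m3 : ∫ y, y ∂η = ∫ y, y ∂ν := by linarith
  have t1 : Tendsto (fun x => ∫ y, |y - x| ∂η - ∫ y, |y - x| ∂ν) atTop (𝓝 0) := by
    have := (pot_atTop η hη).sub (pot_atTop ν hν)
    rw [m3, sub_self] at this
    exact this.congr fun x => by ring
  have t2 : Tendsto (fun x => ∫ y, |y - (-x)| ∂η - ∫ y, |y - (-x)| ∂ν) atTop (𝓝 0) := by
    have := (pot_atBot η hη).sub (pot_atBot ν hν)
    rw [m3, sub_self] at this
    exact this.congr fun x => by ring
  -- the subgradient
  let sg : ℝ → ℝ := fun y => if y ≤ k then 1 else -1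
  have hsgm : Measurable sg := Measurable.ite measurableSet_Iic measurable_const measurable_const
  have hsgi : Integrable sg ν := by
    refine Integrable.mono' (integrable_const (1 : ℝ)) hsgm.aestronglyMeasurable
      (Eventually.of_forall fun y => ?_)
    simp only [sg]
    split_ifs <;> simp
  set c := ∫ y, sg y ∂ν with hcdef
  have htan : ∀ x, ∫ y, |y - k| ∂ν + c * (x - k) ≤ ∫ y, |y - x| ∂ν := by
    intro x
    rw [hcdef, ← integral_mul_const, ← integral_add (lip_integrable hν (lip_abs k))
      (hsgi.mul_const _)]
    refine integral_mono ((lip_integrable hν (lip_abs k)).add (hsgi.mul_const _))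
      (lip_integrable hν (lip_abs x)) fun y => ?_
    simp only [sg]
    split_ifs with hy
    · rw [abs_of_nonpos (by linarith)]
      linarith [neg_abs_le (y - x)]
    · rw [abs_of_nonneg (by linarith)]
      linarith [le_abs_self (y - x)]
  let D : ℝ → ℝ := fun x => ∫ y, |y - x| ∂η - (∫ y, |y - k| ∂ν + c * (x - k))
  have hDc : Continuous D := (lip_pot η hη).continuous.sub (by fun_prop)
  have hDconv : ∀ x y, D ((x + y) / 2) ≤ (D x + D y) / 2 := by
    intro x y
    have : ∫ z, |z - (x + y) / 2| ∂η ≤ (∫ z, |z - x| ∂η + ∫ z, |z - y| ∂η) / 2 := by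
      rw [← integral_add (lip_integrable hη (lip_abs x)) (lip_integrable hη (lip_abs y)),
        ← integral_div]
      refine integral_mono (lip_integrable hη (lip_abs _))
        (((lip_integrable hη (lip_abs x)).add (lip_integrable hη (lip_abs y))).div_const 2)
        fun z => ?_
      have := abs_add_le (z - x) (z - y)
      have e : |z - (x + y) / 2| = |z - x + (z - y)| / 2 := by
        rw [show z - (x + y) / 2 = (z - x + (z - y)) / 2 by ring, abs_div]
        norm_num
      simp only [e, Pi.add_apply]
      linarith
    simp only [D]
    linarith
  have hDk : D k < 0 := by simp only [D, sub_self, mul_zero, add_zero]; linarith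
  obtain ⟨b, hb, hDb⟩ := exists_zero_right hDc hDconv hDk (by
    intro δ hδ
    obtain ⟨x, hx1, hx2⟩ := ((t1.eventually (lt_mem_nhds (show -δ < 0 by linarith))).and
      (eventually_gt_atTop k)).exists
    exact ⟨x, hx2, by simp only [D]; linarith [htan x]⟩)
  obtain ⟨a, ha, hDa⟩ := exists_zero_right (D := fun x => D (-x)) (k := -k)
    (hDc.comp continuous_neg) (by
      intro x y
      have := hDconv (-x) (-y)
      rw [show -((x + y) / 2) = (-x + -y) / 2 by ring]
      exact this) (by simpa using hDk) (by
    intro δ hδ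
    obtain ⟨x, hx1, hx2⟩ := ((t2.eventually (lt_mem_nhds (show -δ < 0 by linarith))).and
      (eventually_gt_atTop (-k))).exists
    exact ⟨x, hx2, by simp only [D]; linarith [htan (-x)]⟩)
  refine ⟨-a, b, c, by linarith, hb, htan, ?_, ?_⟩
  · simp only [D] at hDa
    linarith
  · simp only [D] at hDb
    linarith

/-! ### The elementary spreading kernel -/

/-- probability of jumping up -/
noncomputable def pp (a b x : ℝ) : ℝ≥0 := (min 1 ((x - a) / (b - a))).toNNReal

/-- lower target -/
noncomputable def lo (a b x : ℝ) : ℝ := if x ∈ Ioo a b then a else x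

/-- upper target -/
noncomputable def hi (a b x : ℝ) : ℝ := if x ∈ Ioo a b then b else x

/-- action on functions -/
noncomputable def interp (a b : ℝ) (f : ℝ → ℝ) (x : ℝ) : ℝ :=
  pp a b x * f (hi a b x) + (1 - pp a b x) * f (lo a b x)

lemma pp_le (a b x : ℝ) : pp a b x ≤ 1 := by
  unfold pp
  rw [Real.toNNReal_le_one]
  exact min_le_left _ _

lemma pp_meas (a b : ℝ) : Measurable (pp a b) := by
  unfold pp
  fun_prop

lemma lo_meas (a b : ℝ) : Measurable (lo a b) :=
  Measurable.ite measurableSet_Ioo measurable_const measurable_id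

lemma hi_meas (a b : ℝ) : Measurable (hi a b) :=
  Measurable.ite measurableSet_Ioo measurable_const measurable_id

lemma interp_out {a b x : ℝ} (h : x ∉ Ioo a b) (f : ℝ → ℝ) : interp a b f x = f x := by
  simp only [interp, lo, hi, h, if_false]
  ring

lemma interp_in {a b x : ℝ} (h : x ∈ Ioo a b) (f : ℝ → ℝ) :
    interp a b f x = (x - a) / (b - a) * f b + (b - x) / (b - a) * f a := by
  have hab : 0 < b - a := by linarith [h.1, h.2]
  have e : (pp a b x : ℝ) = (x - a) / (b - a) := by
    unfold pp
    have h1 : (x - a) / (b - a) ≤ 1 := by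
      rw [div_le_one hab]; linarith [h.2]
    have h2 : 0 ≤ (x - a) / (b - a) := div_nonneg (by linarith [h.1]) hab.le
    rw [min_eq_right h1, Real.coe_toNNReal _ h2]
  have e2 : (b - x) / (b - a) = 1 - (x - a) / (b - a) := by
    field_simp
    ring
  simp only [interp, lo, hi, h, if_true, e, e2]

lemma interp_id {a b : ℝ} : interp a b (fun x => x) = fun x => x := by
  ext x
  by_cases h : x ∈ Ioo a b
  · rw [interp_in h]
    have hab : b - a ≠ 0 := by linarith [h.1, h.2]
    field_simp
    ring
  · rw [interp_out h]

lemma interp_lip {a b : ℝ} (hab : a < b) {f : ℝ → ℝ} (hf : LipschitzWith 1 f) :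
    LipschitzWith 1 (interp a b f) := by
  have hba : 0 < b - a := by linarith
  have hf' : ∀ x y, x ≤ y → |f x - f y| ≤ y - x := by
    intro x y hxy
    have := hf.dist_le_mul x y
    simp only [Real.dist_eq, NNReal.coe_one, one_mul] at this
    rwa [abs_sub_comm x y, abs_of_nonneg (show 0 ≤ y - x by linarith)] at this
  set c := (f b - f a) / (b - a) with hc
  have hc1 : |c| ≤ 1 := by
    rw [hc, abs_div, abs_of_pos hba, div_le_one hba, abs_sub_comm]
    exact hf' a b hab.le
  have hfb : f b = f a + c * (b - a) := by rw [hc]; field_simp; ring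
  have hcx : ∀ z, 0 ≤ z → -z ≤ c * z ∧ c * z ≤ z := by
    intro z hz
    have := abs_le.1 hc1
    constructor <;> nlinarith [this.1, this.2]
  have hin : ∀ x, x ∈ Ioo a b → interp a b f x = f a + c * (x - a) := by
    intro x hx
    rw [interp_in hx, hfb]
    field_simp
    ring
  have key : ∀ x y, x ≤ y → |interp a b f x - interp a b f y| ≤ y - x := by
    intro x y hxy
    by_cases hx : x ∈ Ioo a b
    · rw [hin x hx]
      by_cases hy : y ∈ Ioo a b
      · rw [hin y hy]
        have := hcx (y - x) (by linarith)
        rw [abs_le]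
        constructor <;> linarith [this.1, this.2]
      · rw [interp_out hy]
        have hyb : b ≤ y := by
          by_contra hcon
          exact hy ⟨by linarith [hx.1], by linarith⟩
        have h1 := abs_le.1 (hf' b y hyb)
        have h2 := hcx (b - x) (by linarith [hx.2])
        rw [abs_le]
        constructor <;> linarith [h1.1, h1.2, h2.1, h2.2]
    · rw [interp_out hx]
      by_cases hy : y ∈ Ioo a b
      · rw [hin y hy]
        have hxa : x ≤ a := by
          by_contra hcon
          exact hx ⟨by linarith, by linarith [hy.2]⟩
        have h1 := abs_le.1 (hf' x a hxa)
        have h2 := hcx (y - a) (by linarith [hy.1])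
        rw [abs_le]
        constructor <;> linarith [h1.1, h1.2, h2.1, h2.2]
      · rw [interp_out hy]
        exact hf' x y hxy
  refine LipschitzWith.of_dist_le_mul fun x y => ?_
  simp only [Real.dist_eq, NNReal.coe_one, one_mul]
  rcases le_total x y with h | h
  · rw [abs_sub_comm x y, abs_of_nonneg (show 0 ≤ y - x by linarith)]
    exact key x y h
  · rw [abs_sub_comm, abs_of_nonneg (show 0 ≤ x - y by linarith)]
    exact key y x h

lemma interp_abs_in {a b k : ℝ} (ha : a ≤ k) (hb : k ≤ b) (hab : a < b) (x : ℝ) :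
    interp a b (fun y => |y - k|) x = ((b - k) * |x - a| + (k - a) * |x - b|) / (b - a) := by
  have hba : b - a ≠ 0 := by linarith
  by_cases h : x ∈ Ioo a b
  · rw [interp_in h, abs_of_nonneg (show 0 ≤ b - k by linarith),
      abs_of_nonpos (show a - k ≤ 0 by linarith), abs_of_nonneg (show 0 ≤ x - a by linarith [h.1]),
      abs_of_nonpos (show x - b ≤ 0 by linarith [h.2])]
    field_simp
    ring
  · rw [interp_out h]
    rcases le_or_gt x a with hx | hx
    · rw [abs_of_nonpos (show x - k ≤ 0 by linarith), abs_of_nonpos (show x - a ≤ 0 by linarith),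
        abs_of_nonpos (show x - b ≤ 0 by linarith)]
      field_simp
      ring
    · have hx' : b ≤ x := by
        by_contra hcon
        exact h ⟨hx, by linarith⟩
      rw [abs_of_nonneg (show 0 ≤ x - k by linarith), abs_of_nonneg (show 0 ≤ x - a by linarith),
        abs_of_nonneg (show 0 ≤ x - b by linarith)]
      field_simp
      ring

lemma interp_abs_out {a b k : ℝ} (hk : k ≤ a ∨ b ≤ k) (x : ℝ) :
    interp a b (fun y => |y - k|) x = |x - k| := by
  by_cases h : x ∈ Ioo a b
  · have hba : b - a ≠ 0 := by linarith [h.1, h.2]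
    rw [interp_in h]
    rcases hk with hk | hk
    · rw [abs_of_nonneg (show 0 ≤ b - k by linarith [h.1, h.2]),
        abs_of_nonneg (show 0 ≤ a - k by linarith),
        abs_of_nonneg (show 0 ≤ x - k by linarith [h.1])]
      field_simp
      ring
    · rw [abs_of_nonpos (show b - k ≤ 0 by linarith),
        abs_of_nonpos (show a - k ≤ 0 by linarith [h.1, h.2]),
        abs_of_nonpos (show x - k ≤ 0 by linarith [h.2])]
      field_simp
      ring
  · rw [interp_out h]

lemma le_interp_abs {a b : ℝ} (hab : a < b) (k x : ℝ) :
    |x - k| ≤ interp a b (fun y => |y - k|) x := by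
  by_cases h : a ≤ k ∧ k ≤ b
  · rw [interp_abs_in h.1 h.2 hab, le_div_iff₀ (by linarith)]
    have h1 : |(x - k) * (b - a)| = |x - k| * (b - a) := by
      rw [abs_mul, abs_of_pos (show 0 < b - a by linarith)]
    rw [← h1, show (x - k) * (b - a) = (b - k) * (x - a) + (k - a) * (x - b) by ring]
    refine (abs_add_le _ _).trans ?_
    rw [abs_mul, abs_mul, abs_of_nonneg (show 0 ≤ b - k by linarith [h.2]),
      abs_of_nonneg (show 0 ≤ k - a by linarith [h.1])]
  · rw [interp_abs_out]
    by_contra hcon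
    push Not at hcon
    exact h ⟨hcon.1.le, hcon.2.le⟩

end LM

namespace LM

/-! ### Spreading the mass of the process from time `t` on -/

/-- Stop the path at time `t`, moving the final value by `h`. -/
noncomputable def TT (Q : Set ℝ) (t : ↥Q) (h : ℝ → ℝ) (ω : ↥Q → ℝ) : ↥Q → ℝ :=
  open Classical in fun v => if v < t then ω v else h (ω t)

lemma TT_lt {Q : Set ℝ} {t v : ↥Q} (hv : v < t) (h : ℝ → ℝ) (ω : ↥Q → ℝ) :
    TT Q t h ω v = ω v := by
  simp [TT, hv]

lemma TT_ge {Q : Set ℝ} {t v : ↥Q} (hv : t ≤ v) (h : ℝ → ℝ) (ω : ↥Q → ℝ) :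
    TT Q t h ω v = h (ω t) := by
  simp [TT, not_lt.2 hv]

lemma TT_meas {Q : Set ℝ} (t : ↥Q) {h : ℝ → ℝ} (hh : Measurable h) : Measurable (TT Q t h) := by
  refine measurable_pi_lambda _ fun v => ?_
  by_cases hv : v < t
  · simp only [TT_lt hv]
    exact measurable_pi_apply v
  · simp only [TT_ge (not_lt.1 hv)]
    exact hh.comp (measurable_pi_apply t)

/-- The spread measure. -/
noncomputable def spread (Q : Set ℝ) (P : Measure (↥Q → ℝ)) (t : ↥Q) (a b : ℝ) :
    Measure (↥Q → ℝ) :=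
  (P.withDensity (fun ω => (pp a b (ω t) : ℝ≥0∞))).map (TT Q t (hi a b)) +
  (P.withDensity (fun ω => ((1 - pp a b (ω t) : ℝ≥0) : ℝ≥0∞))).map (TT Q t (lo a b))

lemma ppt_meas {Q : Set ℝ} (t : ↥Q) (a b : ℝ) :
    Measurable (fun ω : ↥Q → ℝ => pp a b (ω t)) :=
  (pp_meas a b).comp (measurable_pi_apply t)

lemma qqt_meas {Q : Set ℝ} (t : ↥Q) (a b : ℝ) :
    Measurable (fun ω : ↥Q → ℝ => 1 - pp a b (ω t)) :=
  measurable_const.sub (ppt_meas t a b)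

lemma spread_prob (Q : Set ℝ) (P : Measure (↥Q → ℝ)) [IsProbabilityMeasure P] (t : ↥Q) (a b : ℝ) :
    IsProbabilityMeasure (spread Q P t a b) := by
  constructor
  rw [spread, Measure.add_apply, Measure.map_apply (TT_meas t (hi_meas a b)) MeasurableSet.univ,
    Measure.map_apply (TT_meas t (lo_meas a b)) MeasurableSet.univ, preimage_univ, preimage_univ,
    withDensity_apply _ MeasurableSet.univ, withDensity_apply _ MeasurableSet.univ,
    Measure.restrict_univ, ← lintegral_add_left (ppt_meas t a b).coe_nnreal_ennreal]
  have : ∀ ω : ↥Q → ℝ, (pp a b (ω t) : ℝ≥0∞) + ((1 - pp a b (ω t) : ℝ≥0) : ℝ≥0∞) = 1 := by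
    intro ω
    rw [← ENNReal.coe_add, add_tsub_cancel_of_le (pp_le a b _), ENNReal.coe_one]
  simp only [this]
  simp

lemma wd_int {Ω : Type*} [MeasurableSpace Ω] {P : Measure Ω} {p : Ω → ℝ≥0} (hp : Measurable p)
    (hp1 : ∀ ω, p ω ≤ 1) {h : Ω → ℝ} (hh : Integrable h P) :
    Integrable (fun ω => (p ω : ℝ) * h ω) P := by
  refine hh.bdd_mul (c := 1) hp.coe_nnreal_real.aestronglyMeasurable
    (Eventually.of_forall fun ω => ?_)
  rw [Real.norm_of_nonneg (NNReal.coe_nonneg _)]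
  exact_mod_cast hp1 ω

lemma spread_integral (Q : Set ℝ) (P : Measure (↥Q → ℝ)) [IsProbabilityMeasure P] (t : ↥Q)
    (a b : ℝ) {H : (↥Q → ℝ) → ℝ} (hH : Measurable H)
    (h1 : Integrable (fun ω => H (TT Q t (hi a b) ω)) P)
    (h2 : Integrable (fun ω => H (TT Q t (lo a b) ω)) P) :
    Integrable H (spread Q P t a b) ∧ ∫ ω, H ω ∂(spread Q P t a b) =
      ∫ ω, (pp a b (ω t) * H (TT Q t (hi a b) ω) + (1 - pp a b (ω t)) * H (TT Q t (lo a b) ω))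
        ∂P := by
  have q1 : ∀ ω : ↥Q → ℝ, 1 - pp a b (ω t) ≤ 1 := fun ω => tsub_le_self
  have qc : ∀ ω : ↥Q → ℝ, ((1 - pp a b (ω t) : ℝ≥0) : ℝ) = 1 - pp a b (ω t) := fun ω => by
    rw [NNReal.coe_sub (pp_le a b _), NNReal.coe_one]
  have i1 := wd_int (ppt_meas t a b) (fun ω => pp_le a b (ω t)) h1
  have i2 := wd_int (qqt_meas t a b) q1 h2
  have m1 := TT_meas t (hi_meas a b)
  have m2 := TT_meas t (lo_meas a b)
  have j1 : Integrable H ((P.withDensity (fun ω => (pp a b (ω t) : ℝ≥0∞))).map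
      (TT Q t (hi a b))) := by
    rw [integrable_map_measure hH.aestronglyMeasurable m1.aemeasurable,
      integrable_withDensity_iff_integrable_smul (ppt_meas t a b)]
    exact i1
  have j2 : Integrable H ((P.withDensity (fun ω => ((1 - pp a b (ω t) : ℝ≥0) : ℝ≥0∞))).map
      (TT Q t (lo a b))) := by
    rw [integrable_map_measure hH.aestronglyMeasurable m2.aemeasurable,
      integrable_withDensity_iff_integrable_smul (qqt_meas t a b)]
    exact i2
  refine ⟨j1.add_measure j2, ?_⟩
  rw [spread, integral_add_measure j1 j2,
    integral_map m1.aemeasurable hH.aestronglyMeasurable,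
    integral_map m2.aemeasurable hH.aestronglyMeasurable,
    integral_withDensity_eq_integral_smul (ppt_meas t a b),
    integral_withDensity_eq_integral_smul (qqt_meas t a b)]
  simp only [qc] at i2
  rw [integral_add i1 i2]
  simp only [NNReal.smul_def, smul_eq_mul, qc]

lemma hi_integrable {Ω : Type*} [MeasurableSpace Ω] {P : Measure Ω} [IsProbabilityMeasure P]
    {Z : Ω → ℝ} (hm : Measurable Z) (hZ : Integrable Z P) (a b : ℝ) :
    Integrable (fun ω => hi a b (Z ω)) P ∧ Integrable (fun ω => lo a b (Z ω)) P := by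
  have hd : Integrable (fun ω => |Z ω| + (|a| + |b|)) P := hZ.abs.add (integrable_const _)
  constructor
  · refine hd.mono' ((hi_meas a b).comp hm).aestronglyMeasurable (Eventually.of_forall fun ω => ?_)
    unfold hi
    rw [Real.norm_eq_abs]
    split_ifs <;> linarith [abs_nonneg a, abs_nonneg b, abs_nonneg (Z ω)]
  · refine hd.mono' ((lo_meas a b).comp hm).aestronglyMeasurable (Eventually.of_forall fun ω => ?_)
    unfold lo
    rw [Real.norm_eq_abs]
    split_ifs <;> linarith [abs_nonneg a, abs_nonneg b, abs_nonneg (Z ω)]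

/-- Integrals of `Y * f (ω u)` under the spread measure. -/
lemma spread_Yf (Q : Set ℝ) [Countable ↥Q] (P : Measure (↥Q → ℝ)) [IsProbabilityMeasure P]
    (hP : ∀ t : ↥Q, Integrable (fun ω : ↥Q → ℝ => ω t) P) (t : ↥Q)
    (a b : ℝ) {f : ℝ → ℝ} (hf : LipschitzWith 1 f) (s u : ↥Q) (Y : (↥(Set.Iic s) → ℝ) →ᵇ ℝ) :
    Integrable (fun ω => Y (fun i => ω i) * f (ω u)) (spread Q P t a b) ∧
    ∫ ω, Y (fun i => ω i) * f (ω u) ∂(spread Q P t a b) =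
      ∫ ω, (pp a b (ω t) * (Y (fun i => TT Q t (hi a b) ω i) * f (TT Q t (hi a b) ω u)) +
        (1 - pp a b (ω t)) * (Y (fun i => TT Q t (lo a b) ω i) * f (TT Q t (lo a b) ω u))) ∂P := by
  have hh := hi_integrable (measurable_pi_apply t) (hP t) a b
  have key : ∀ h : ℝ → ℝ, Measurable h → Integrable (fun ω : ↥Q → ℝ => h (ω t)) P →
      Integrable (fun ω => Y (fun i => TT Q t h ω i) * f (TT Q t h ω u)) P := by
    intro h hm hi
    refine bcf_mul_integrable (lip_integrable ?_ hf) Y ((r_meas Q s).comp (TT_meas t hm))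
    by_cases hu : u < t
    · simp only [TT_lt hu]
      exact hP u
    · simp only [TT_ge (not_lt.1 hu)]
      exact hi
  exact spread_integral Q P t a b
    (((Y.continuous.measurable.comp (r_meas Q s))).mul
      (hf.continuous.measurable.comp (measurable_pi_apply u)))
    (key _ (hi_meas a b) hh.1) (key _ (lo_meas a b) hh.2)

lemma spread_Yf_lt (Q : Set ℝ) [Countable ↥Q] (P : Measure (↥Q → ℝ)) [IsProbabilityMeasure P]
    (hP : ∀ t : ↥Q, Integrable (fun ω : ↥Q → ℝ => ω t) P) (t : ↥Q)
    (a b : ℝ) {f : ℝ → ℝ} (hf : LipschitzWith 1 f) (s u : ↥Q) (Y : (↥(Set.Iic s) → ℝ) →ᵇ ℝ)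
    (hs : s < t) (hu : u < t) :
    ∫ ω, Y (fun i => ω i) * f (ω u) ∂(spread Q P t a b) =
      ∫ ω, Y (fun i => ω i) * f (ω u) ∂P := by
  rw [(spread_Yf Q P hP t a b hf s u Y).2]
  refine integral_congr_ae (Eventually.of_forall fun ω => ?_)
  have e : ∀ h (i : ↥(Set.Iic s)), TT Q t h ω i = ω i := fun h i => TT_lt (lt_of_le_of_lt i.2 hs) h ω
  simp only [TT_lt hu, e]
  ring

lemma spread_Yf_ge (Q : Set ℝ) [Countable ↥Q] (P : Measure (↥Q → ℝ)) [IsProbabilityMeasure P]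
    (hP : ∀ t : ↥Q, Integrable (fun ω : ↥Q → ℝ => ω t) P) (t : ↥Q)
    (a b : ℝ) {f : ℝ → ℝ} (hf : LipschitzWith 1 f) (s u : ↥Q) (Y : (↥(Set.Iic s) → ℝ) →ᵇ ℝ)
    (hs : s < t) (hu : t ≤ u) :
    ∫ ω, Y (fun i => ω i) * f (ω u) ∂(spread Q P t a b) =
      ∫ ω, Y (fun i => ω i) * interp a b f (ω t) ∂P := by
  rw [(spread_Yf Q P hP t a b hf s u Y).2]
  refine integral_congr_ae (Eventually.of_forall fun ω => ?_)
  have e : ∀ h (i : ↥(Set.Iic s)), TT Q t h ω i = ω i := fun h i => TT_lt (lt_of_le_of_lt i.2 hs) h ω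
  simp only [TT_ge hu, e, interp]
  ring

lemma spread_f_lt (Q : Set ℝ) [Countable ↥Q] (P : Measure (↥Q → ℝ)) [IsProbabilityMeasure P]
    (hP : ∀ t : ↥Q, Integrable (fun ω : ↥Q → ℝ => ω t) P) (t : ↥Q)
    (a b : ℝ) {f : ℝ → ℝ} (hf : LipschitzWith 1 f) (u : ↥Q) (hu : u < t) :
    ∫ ω, f (ω u) ∂(spread Q P t a b) = ∫ ω, f (ω u) ∂P := by
  have := spread_Yf_lt Q P hP t a b hf u u (BoundedContinuousFunction.const _ 1) hu hu
  simpa using this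

lemma spread_f_ge (Q : Set ℝ) [Countable ↥Q] (P : Measure (↥Q → ℝ)) [IsProbabilityMeasure P]
    (hP : ∀ t : ↥Q, Integrable (fun ω : ↥Q → ℝ => ω t) P) (t : ↥Q)
    (a b : ℝ) {f : ℝ → ℝ} (hf : LipschitzWith 1 f) (u : ↥Q) (hu : t ≤ u) :
    ∫ ω, f (ω u) ∂(spread Q P t a b) = ∫ ω, interp a b f (ω t) ∂P := by
  have := (spread_Yf Q P hP t a b hf u u (BoundedContinuousFunction.const _ 1)).2
  simp only [BoundedContinuousFunction.const_apply, one_mul, TT_ge hu] at this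
  exact this

lemma spread_SS (Q : Set ℝ) [Countable ↥Q] (μ : ↥Q → ProbabilityMeasure ℝ)
    (hmono : ∀ s v : ↥Q, s ≤ v → ∀ k : ℝ, ∫ x, |x - k| ∂(μ s : Measure ℝ) ≤
      ∫ x, |x - k| ∂(μ v : Measure ℝ))
    (P : ProbabilityMeasure (↥Q → ℝ)) (hP : P ∈ SS Q μ) (t : ↥Q) {a b : ℝ} (hab : a < b)
    (hle : ∀ k : ℝ, ∫ ω : ↥Q → ℝ, interp a b (fun y => |y - k|) (ω t) ∂(P : Measure (↥Q → ℝ)) ≤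
      ∫ x, |x - k| ∂(μ t : Measure ℝ)) :
    (⟨spread Q P t a b, spread_prob Q P t a b⟩ : ProbabilityMeasure (↥Q → ℝ)) ∈ SS Q μ := by
  obtain ⟨hI, hM, hL, hU⟩ := hP
  refine ⟨fun u => ?_, ?_, ?_, ?_⟩
  · have := (spread_Yf Q P hI t a b lip_id u u (BoundedContinuousFunction.const _ 1)).1
    simpa using this
  · intro s u hsu Y
    simp only [ProbabilityMeasure.coe_mk]
    rcases lt_or_ge u t with hu | hu
    · have hs := hsu.trans hu
      rw [spread_Yf_lt Q P hI t a b lip_id s u Y hs hu,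
        spread_Yf_lt Q P hI t a b lip_id s s Y hs hs]
      exact hM s u hsu Y
    · rcases lt_or_ge s t with hs | hs
      · rw [spread_Yf_ge Q P hI t a b lip_id s u Y hs hu,
          spread_Yf_lt Q P hI t a b lip_id s s Y hs hs, interp_id]
        exact hM s t hs Y
      · rw [(spread_Yf Q P hI t a b lip_id s u Y).2, (spread_Yf Q P hI t a b lip_id s s Y).2]
        simp only [TT_ge hu, TT_ge hs]
  · intro s u hsu f hf
    rcases lt_or_ge u t with hu | hu
    · have hs := hsu.trans hu
      obtain ⟨g, hg, h⟩ := hL s u hsu f hf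
      refine ⟨g, hg, fun Y => ?_⟩
      simp only [ProbabilityMeasure.coe_mk]
      rw [spread_Yf_lt Q P hI t a b hf s u Y hs hu,
        spread_Yf_lt Q P hI t a b hg s s Y hs hs]
      exact h Y
    · rcases lt_or_ge s t with hs | hs
      · obtain ⟨g, hg, h⟩ := hL s t hs _ (interp_lip hab hf)
        refine ⟨g, hg, fun Y => ?_⟩
        simp only [ProbabilityMeasure.coe_mk]
        rw [spread_Yf_ge Q P hI t a b hf s u Y hs hu,
          spread_Yf_lt Q P hI t a b hg s s Y hs hs]
        exact h Y
      · refine ⟨f, hf, fun Y => ?_⟩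
        simp only [ProbabilityMeasure.coe_mk]
        rw [(spread_Yf Q P hI t a b hf s u Y).2, (spread_Yf Q P hI t a b hf s s Y).2]
        simp only [TT_ge hu, TT_ge hs]
  · intro u k
    simp only [ProbabilityMeasure.coe_mk]
    rcases lt_or_ge u t with hu | hu
    · rw [spread_f_lt Q P hI t a b (lip_abs k) u hu]
      exact hU u k
    · rw [spread_f_ge Q P hI t a b (lip_abs k) u hu]
      exact (hle k).trans (hmono t u hu k)

lemma step (Q : Set ℝ) [Countable ↥Q] (μ : ↥Q → ProbabilityMeasure ℝ)
    (hmom : ∀ t, Integrable (fun x => |x|) (μ t : Measure ℝ))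
    (hmono : ∀ s v : ↥Q, s ≤ v → ∀ k : ℝ, ∫ x, |x - k| ∂(μ s : Measure ℝ) ≤
      ∫ x, |x - k| ∂(μ v : Measure ℝ))
    (P : ProbabilityMeasure (↥Q → ℝ)) (hP : P ∈ SS Q μ) (t : ↥Q) (k : ℝ) :
    ∃ P' ∈ SS Q μ,
      (∀ v ≤ t, ∀ k' : ℝ, ∫ ω : ↥Q → ℝ, |ω v - k'| ∂(P : Measure (↥Q → ℝ)) ≤
        ∫ ω : ↥Q → ℝ, |ω v - k'| ∂(P' : Measure (↥Q → ℝ))) ∧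
      ∫ x, |x - k| ∂(μ t : Measure ℝ) ≤ ∫ ω : ↥Q → ℝ, |ω t - k| ∂(P' : Measure (↥Q → ℝ)) := by
  by_cases hk : ∫ x, |x - k| ∂(μ t : Measure ℝ) ≤ ∫ ω : ↥Q → ℝ, |ω t - k| ∂(P : Measure (↥Q → ℝ))
  · exact ⟨P, hP, fun _ _ _ => le_rfl, hk⟩
  push Not at hk
  have hmt : Measurable (fun ω : ↥Q → ℝ => ω t) := measurable_pi_apply t
  have hI := hP.1
  set η : Measure ℝ := (P : Measure (↥Q → ℝ)).map (fun ω => ω t) with hη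
  have hηp : IsProbabilityMeasure η := Measure.isProbabilityMeasure_map hmt.aemeasurable
  have hηU : ∀ k' : ℝ, ∫ x, |x - k'| ∂η = ∫ ω : ↥Q → ℝ, |ω t - k'| ∂(P : Measure (↥Q → ℝ)) := by
    intro k'
    rw [hη, integral_map hmt.aemeasurable (lip_abs k').continuous.aestronglyMeasurable]
  have hηI : Integrable (fun x : ℝ => x) η := by
    exact (integrable_map_measure (g := fun x : ℝ => x) aestronglyMeasurable_id hmt.aemeasurable).2 (hI t)
  have hνI : Integrable (fun x : ℝ => x) (μ t : Measure ℝ) :=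
    (integrable_norm_iff aestronglyMeasurable_id).1 (hmom t)
  obtain ⟨a, b, c, hak, hkb, hsup, ha, hb⟩ := exists_interval η (μ t) hηI hνI
    (fun k' => by rw [hηU]; exact hP.2.2.2 t k') k (by rw [hηU]; exact hk)
  rw [hηU] at ha hb
  have hab : a < b := hak.trans hkb
  have hba : b - a ≠ 0 := by linarith
  have hin : ∀ k', a ≤ k' → k' ≤ b →
      ∫ ω : ↥Q → ℝ, interp a b (fun y => |y - k'|) (ω t) ∂(P : Measure (↥Q → ℝ)) =
      ∫ y, |y - k| ∂(μ t : Measure ℝ) + c * (k' - k) := by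
    intro k' h1 h2
    simp only [interp_abs_in h1 h2 hab]
    rw [integral_div, integral_add ((lip_integrable (hI t) (lip_abs a)).const_mul _)
      ((lip_integrable (hI t) (lip_abs b)).const_mul _), integral_const_mul, integral_const_mul,
      ha, hb]
    field_simp
    ring
  have hle : ∀ k' : ℝ, ∫ ω : ↥Q → ℝ, interp a b (fun y => |y - k'|) (ω t)
      ∂(P : Measure (↥Q → ℝ)) ≤ ∫ x, |x - k'| ∂(μ t : Measure ℝ) := by
    intro k'
    by_cases h : a ≤ k' ∧ k' ≤ b
    · rw [hin k' h.1 h.2]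
      exact hsup k'
    · have h' : k' ≤ a ∨ b ≤ k' := by
        by_contra hcon
        push Not at hcon
        exact h ⟨hcon.1.le, hcon.2.le⟩
      simp only [interp_abs_out h']
      exact hP.2.2.2 t k'
  refine ⟨⟨spread Q P t a b, spread_prob Q P t a b⟩, spread_SS Q μ hmono P hP t hab hle, ?_, ?_⟩
  · intro v hv k'
    simp only [ProbabilityMeasure.coe_mk]
    rcases lt_or_ge v t with h | h
    · rw [spread_f_lt Q P hI t a b (lip_abs k') v h]
    · obtain rfl : v = t := le_antisymm hv h
      rw [spread_f_ge Q P hI v a b (lip_abs k') v le_rfl]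
      exact integral_mono (lip_integrable (hI v) (lip_abs k'))
        (lip_integrable (hI v) (interp_lip hab (lip_abs k')))
        fun ω => le_interp_abs hab k' (ω v)
  · simp only [ProbabilityMeasure.coe_mk]
    rw [spread_f_ge Q P hI t a b (lip_abs k) t le_rfl, hin k hak.le hkb.le]
    simp

lemma finite_nonempty (Q : Set ℝ) [Countable ↥Q] (μ : ↥Q → ProbabilityMeasure ℝ)
    (hmom : ∀ t, Integrable (fun x => |x|) (μ t : Measure ℝ))
    (hmono : ∀ s v : ↥Q, s ≤ v → ∀ k : ℝ, ∫ x, |x - k| ∂(μ s : Measure ℝ) ≤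
      ∫ x, |x - k| ∂(μ v : Measure ℝ))
    (m : ℝ) (hm : ∀ t, ∫ x, x ∂(μ t : Measure ℝ) = m) (u : Finset (↥Q × ℝ)) :
    ∃ P ∈ SS Q μ, ∀ i ∈ u, ∫ x, |x - i.2| ∂(μ i.1 : Measure ℝ) ≤
      ∫ ω : ↥Q → ℝ, |ω i.1 - i.2| ∂(P : Measure (↥Q → ℝ)) := by
  classical
  induction u using Finset.induction_on_max_value (fun i : ↥Q × ℝ => i.1) with
  | empty =>
    refine ⟨⟨Measure.dirac (fun _ => m), inferInstance⟩, ⟨?_, ?_, ?_, ?_⟩, by simp⟩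
    · intro t
      simp only [ProbabilityMeasure.coe_mk]
      exact integrable_dirac (by simp)
    · intro s t _ Y
      simp
    · intro s t _ f hf
      refine ⟨f, hf, fun Y => ?_⟩
      simp
    · intro t k
      have hνI : Integrable (fun x : ℝ => x) (μ t : Measure ℝ) :=
        (integrable_norm_iff aestronglyMeasurable_id).1 (hmom t)
      have h1 := abs_integral_le_integral_abs (f := fun x : ℝ => x - k) (μ := (μ t : Measure ℝ))
      rw [integral_sub hνI (integrable_const k), hm] at h1
      simpa using h1
  | insert i s his hmax ih =>
    obtain ⟨P, hP, h⟩ := ih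
    obtain ⟨P', hP', h1, h2⟩ := step Q μ hmom hmono P hP i.1 i.2
    refine ⟨P', hP', fun j hj => ?_⟩
    rcases Finset.mem_insert.1 hj with rfl | hj
    · exact h2
    · exact (h j hj).trans (h1 j.1 (hmax j hj) j.2)

lemma part_two (Q : Set ℝ) [Countable ↥Q] (hQsub : Q ⊆ Icc (0 : ℝ) 1) (h1Q : (1 : ℝ) ∈ Q)
    (μ : ↥Q → ProbabilityMeasure ℝ)
    (hmom : ∀ t, Integrable (fun x => |x|) (μ t : Measure ℝ))
    (hpeacock : ∀ s t : ↥Q, s ≤ t → ConvexOrder (μ s : Measure ℝ) (μ t : Measure ℝ)) :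
    (LQ Q μ).Nonempty ∧ IsCompact (LQ Q μ) := by
  have hI : ∀ t, Integrable (fun x : ℝ => x) (μ t : Measure ℝ) := fun t =>
    (integrable_norm_iff aestronglyMeasurable_id).1 (hmom t)
  have hmono : ∀ s v : ↥Q, s ≤ v → ∀ k : ℝ, ∫ x, |x - k| ∂(μ s : Measure ℝ) ≤
      ∫ x, |x - k| ∂(μ v : Measure ℝ) := by
    intro s v hsv k
    refine hpeacock s v hsv (fun x => |x - k|) ?_ (lip_integrable (hI s) (lip_abs k))
      (lip_integrable (hI v) (lip_abs k))
    refine ⟨convex_univ, fun x _ y _ α β hα hβ hαβ => ?_⟩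
    simp only [smul_eq_mul]
    have e : α * x + β * y - k = α * (x - k) + β * (y - k) := by
      have : β = 1 - α := by linarith
      subst this
      ring
    rw [e]
    refine (abs_add_le _ _).trans ?_
    rw [abs_mul, abs_mul, abs_of_nonneg hα, abs_of_nonneg hβ]
  have hm : ∀ t, ∫ x, x ∂(μ t : Measure ℝ) = ∫ x, x ∂(μ ⟨1, h1Q⟩ : Measure ℝ) := by
    intro t
    have ht : t ≤ ⟨1, h1Q⟩ := (hQsub t.2).2
    have a1 := hpeacock t _ ht (fun x => x) (convexOn_id convex_univ) (hI _) (hI _)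
    have a2 := hpeacock t _ ht (fun x => -x) (concaveOn_id convex_univ).neg (hI _).neg (hI _).neg
    rw [integral_neg, integral_neg] at a2
    linarith
  rw [LQ_eq Q μ hmom]
  have hcl : ∀ i : ↥Q × ℝ, IsClosed (SS Q μ ∩ {P | ∫ x, |x - i.2| ∂(μ i.1 : Measure ℝ) ≤
      ∫ ω : ↥Q → ℝ, |ω i.1 - i.2| ∂(P : Measure (↥Q → ℝ))}) := fun i => T_closed Q μ hmom i.1 i.2
  refine ⟨?_, (SS_compact Q μ hmom).inter_right (isClosed_iInter hcl)⟩
  refine (SS_compact Q μ hmom).inter_iInter_nonempty _ hcl fun u => ?_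
  obtain ⟨P, hP, h⟩ := finite_nonempty Q μ hmom hmono _ hm u
  exact ⟨P, hP, mem_iInter₂.2 fun i hi => ⟨hP, h i hi⟩⟩

end LM

/-- the Lipschitz-Markov property is closed under weak convergence (given
uniformly integrable marginals); in particular, for a countable `Q ∋ 1` and a peacock
`(μ_t)_{t∈Q}`, the set `L((μ_t)_{t∈Q})` is nonempty and compact. -/
theorem lipschitz_markov_closed_and_LQ_nonempty_compact
    (Q : Set ℝ) [Countable ↥Q] (hQsub : Q ⊆ Icc (0 : ℝ) 1) (h1Q : (1 : ℝ) ∈ Q)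
    (μ : ↥Q → ProbabilityMeasure ℝ)
    (hmom : ∀ t, Integrable (fun x => |x|) (μ t : Measure ℝ))
    (hpeacock : ∀ s t : ↥Q, s ≤ t → ConvexOrder (μ s : Measure ℝ) (μ t : Measure ℝ)) :
    (∀ (Pn : ℕ → ProbabilityMeasure (↥Q → ℝ)) (P : ProbabilityMeasure (↥Q → ℝ)),
      (∀ n, Martingale (fun (t : ↥Q) (ω : ↥Q → ℝ) => ω t) (natFiltration ↥Q)
        (Pn n : Measure (↥Q → ℝ))) →
      (∀ n, LipschitzMarkov Q (Pn n : Measure (↥Q → ℝ))) →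
      Martingale (fun (t : ↥Q) (ω : ↥Q → ℝ) => ω t) (natFiltration ↥Q)
        (P : Measure (↥Q → ℝ)) →
      Tendsto Pn atTop (𝓝 P) →
      (∀ ε : ℝ, 0 < ε → ∃ C : ℝ, ∀ n (t : ↥Q),
        ∫ ω in {ω : ↥Q → ℝ | C ≤ |ω t|}, |ω t| ∂(Pn n : Measure (↥Q → ℝ)) ≤ ε) →
      LipschitzMarkov Q (P : Measure (↥Q → ℝ))) ∧
    ((LQ Q μ).Nonempty ∧ IsCompact (LQ Q μ)) := by
  exact ⟨fun Pn P hM hL hP hT hUI => LM.part_one Q Pn P hM hL hP hT hUI,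
    LM.part_two Q hQsub h1Q μ hmom hpeacock⟩
end

section
/- Let (μ_t)_{t∈[0,1]} be a right-continuous peacock, Q ∋ 1 countable dense in [0,1], and P ∈ L((μ_t)_{t∈Q}) a Lipschitz-Markov martingale measure on ℝ^Q. Then the corresponding càdlàg martingale measure P̃ on Skorokhod space D is Lipschitz-Markov with respect to the right-continuous filtration F⁺: for all s < t in [0,1] and f ∈ Lip₁ there is g ∈ Lip₁ with E_{P̃}[f(S_t) | F⁺_s] = g(S_s). In particular there exists a strong Markov càdlàg martingale with marginals (μ_t)_{t∈[0,1]} (Kellerer's theorem). -/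
open MeasureTheory Set Filter Topology

/-- `g` is càdlàg on `[0,1]`. -/
def CadlagOn01 (g : ℝ → ℝ) : Prop :=
  (∀ x ∈ Ico (0 : ℝ) 1, Tendsto g (𝓝[>] x) (𝓝 (g x))) ∧
  (∀ x ∈ Ioc (0 : ℝ) 1, ∃ L : ℝ, Tendsto g (𝓝[<] x) (𝓝 L))

/-- The Skorokhod-type space of càdlàg paths `[0,1] → ℝ`. -/
def Dspace : Type := {g : ℝ → ℝ // CadlagOn01 g}

/-- The canonical σ-algebra on `D`, generated by the evaluations `S_t`, `t ∈ [0,1]`. -/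
noncomputable instance : MeasurableSpace Dspace :=
  ⨆ t ∈ Icc (0 : ℝ) 1, MeasurableSpace.comap (fun g : Dspace => g.1 t) inferInstance

/-- The natural filtration `F_t` on `D`. -/
noncomputable def FD (t : ℝ) : MeasurableSpace Dspace :=
  ⨆ r ∈ Icc (0 : ℝ) t, MeasurableSpace.comap (fun g : Dspace => g.1 r) inferInstance

/-- The right-continuous filtration `F⁺` on `D`. -/
noncomputable def FDplus (s : ℝ) : MeasurableSpace Dspace :=
  if s = 1 then FD 1 else ⨅ t ∈ Ioc s (1 : ℝ), FD t

/-- The set `M((μ_t)_{t∈[0,1]})` of càdlàg martingale measures with marginals `(μ_t)`. -/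
def MI (μ : ℝ → ProbabilityMeasure ℝ) : Set (Measure Dspace) :=
  {P | IsProbabilityMeasure P ∧
    (∀ t ∈ Icc (0 : ℝ) 1, P.map (fun g : Dspace => g.1 t) = (μ t : Measure ℝ)) ∧
    (∀ t ∈ Icc (0 : ℝ) 1, Integrable (fun g : Dspace => g.1 t) P) ∧
    (∀ s t : ℝ, 0 ≤ s → s ≤ t → t ≤ 1 →
      P[(fun g : Dspace => g.1 t) | FDplus s] =ᵐ[P] fun g : Dspace => g.1 s)}

/-- A measure on `D` is Lipschitz-Markov w.r.t. the right-continuous filtration `F⁺` if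
for all `s < t` in `[0,1]` and `1`-Lipschitz `f` there is a `1`-Lipschitz `g` with
`E[f(S_t) | F⁺_s] = g(S_s)`. -/
def LipschitzMarkovD (P : Measure Dspace) : Prop :=
  ∀ s t : ℝ, 0 ≤ s → s < t → t ≤ 1 → ∀ f : ℝ → ℝ, LipschitzWith 1 f →
    ∃ g : ℝ → ℝ, LipschitzWith 1 g ∧
      P[(fun w : Dspace => f (w.1 t)) | FDplus s] =ᵐ[P] fun w : Dspace => g (w.1 s)

/-- The Lipschitz-Markov property for a measure on `ℝ^Q`. -/
def LipschitzMarkovQ (Q : Set ℝ) (P : Measure (↥Q → ℝ)) : Prop :=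
  ∀ s t : ↥Q, s < t → ∀ f : ℝ → ℝ, LipschitzWith 1 f →
    ∃ g : ℝ → ℝ, LipschitzWith 1 g ∧
      P[(fun ω : ↥Q → ℝ => f (ω t)) | natFiltration ↥Q s] =ᵐ[P] fun ω => g (ω s)


namespace Kel

/-- filter of right neighbourhoods of `x` in `Q` -/
def rightF (Q : Set ℝ) (x : ℝ) : Filter ↥Q := Filter.comap (fun q : ↥Q => (q : ℝ)) (𝓝[>] x)

def leftF (Q : Set ℝ) (x : ℝ) : Filter ↥Q := Filter.comap (fun q : ↥Q => (q : ℝ)) (𝓝[<] x)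

instance (Q : Set ℝ) (x : ℝ) : (rightF Q x).IsCountablyGenerated := by
  unfold rightF; infer_instance

lemma exists_mem_Ioo {Q : Set ℝ} (hQdense : Icc (0 : ℝ) 1 ⊆ closure Q) {x y : ℝ}
    (hx : 0 ≤ x) (hxy : x < y) (hx1 : x < 1) : ∃ q ∈ Q, x < q ∧ q < y := by
  have hz : x < min y 1 := lt_min hxy hx1
  obtain ⟨z, hz1, hz2⟩ := exists_between hz
  have hzc : z ∈ closure Q := hQdense ⟨by linarith, (hz2.trans_le (min_le_right _ _)).le⟩
  rw [mem_closure_iff] at hzc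
  obtain ⟨q, hq1, hq2⟩ := hzc (Ioo x (min y 1)) isOpen_Ioo ⟨hz1, hz2⟩
  exact ⟨q, hq2, hq1.1, hq1.2.trans_le (min_le_left _ _)⟩

lemma rightF_neBot {Q : Set ℝ} (hQdense : Icc (0 : ℝ) 1 ⊆ closure Q) {x : ℝ}
    (hx : 0 ≤ x) (hx1 : x < 1) : (rightF Q x).NeBot := by
  unfold rightF
  rw [Filter.comap_neBot_iff]
  intro t ht
  rw [mem_nhdsGT_iff_exists_Ioo_subset] at ht
  obtain ⟨u, hu, hut⟩ := ht
  obtain ⟨q, hq, h1, h2⟩ := exists_mem_Ioo hQdense hx hu hx1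
  exact ⟨⟨q, hq⟩, hut ⟨h1, h2⟩⟩

lemma exists_seq {Q : Set ℝ} (hQdense : Icc (0 : ℝ) 1 ⊆ closure Q) {x : ℝ}
    (hx : 0 ≤ x) (hx1 : x < 1) : ∃ u : ℕ → ↥Q, Tendsto u atTop (rightF Q x) := by
  haveI := rightF_neBot hQdense hx hx1
  exact Filter.exists_seq_tendsto _

lemma seq_tendsto {Q : Set ℝ} {x : ℝ} {u : ℕ → ↥Q} (hu : Tendsto u atTop (rightF Q x)) :
    Tendsto (fun n => (u n : ℝ)) atTop (𝓝[>] x) := Filter.tendsto_comap.comp hu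

lemma FD_le {t : ℝ} (ht : t ≤ 1) : FD t ≤ (inferInstance : MeasurableSpace Dspace) := by
  refine iSup₂_le fun r hr => ?_
  exact le_iSup₂ (f := fun (r : ℝ) (_ : r ∈ Icc (0:ℝ) 1) =>
      MeasurableSpace.comap (fun g : Dspace => g.1 r) inferInstance) r ⟨hr.1, hr.2.trans ht⟩

lemma FD_mono {s t : ℝ} (h : s ≤ t) : FD s ≤ FD t := by
  refine iSup₂_le fun r hr => ?_
  exact le_iSup₂ (f := fun (r : ℝ) (_ : r ∈ Icc (0:ℝ) t) =>
      MeasurableSpace.comap (fun g : Dspace => g.1 r) inferInstance) r ⟨hr.1, hr.2.trans h⟩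

lemma meas_FD {r t : ℝ} (h0 : 0 ≤ r) (h : r ≤ t) : Measurable[FD t] (fun g : Dspace => g.1 r) := by
  rw [measurable_iff_comap_le]
  exact le_iSup₂ (f := fun (r : ℝ) (_ : r ∈ Icc (0:ℝ) t) =>
      MeasurableSpace.comap (fun g : Dspace => g.1 r) inferInstance) r ⟨h0, h⟩

lemma meas_eval {r : ℝ} (h0 : 0 ≤ r) (h : r ≤ 1) : Measurable (fun g : Dspace => g.1 r) :=
  (meas_FD h0 h).mono (FD_le le_rfl) le_rfl

lemma FDplus_le_FD {s t : ℝ} (h : s < t) (ht : t ≤ 1) : FDplus s ≤ FD t := by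
  unfold FDplus
  rw [if_neg (by linarith)]
  exact iInf₂_le t ⟨h, ht⟩

lemma FD_le_FDplus {s : ℝ} : FD s ≤ FDplus s := by
  unfold FDplus
  split_ifs with h
  · rw [h]
  · exact le_iInf₂ fun t ht => FD_mono ht.1.le

lemma FDplus_le {s : ℝ} (hs : s ≤ 1) : FDplus s ≤ (inferInstance : MeasurableSpace Dspace) := by
  rcases hs.eq_or_lt with h | h
  · unfold FDplus
    rw [if_pos h]
    exact FD_le le_rfl
  · exact (FDplus_le_FD h le_rfl).trans (FD_le le_rfl)

lemma FDplus_mono {s t : ℝ} (h : s ≤ t) (ht : t ≤ 1) : FDplus s ≤ FDplus t := by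
  rcases h.eq_or_lt with h | h
  · rw [h]
  · exact (FDplus_le_FD h ht).trans FD_le_FDplus

/-- restriction of a path to `Q` -/
def restr (Q : Set ℝ) : Dspace → (↥Q → ℝ) := fun g q => g.1 q

lemma meas_restr {Q : Set ℝ} (hQsub : Q ⊆ Icc (0 : ℝ) 1) : Measurable (restr Q) :=
  measurable_pi_lambda _ fun q => meas_eval (hQsub q.2).1 (hQsub q.2).2

lemma nat_meas {Q : Set ℝ} {r q : ↥Q} (h : r ≤ q) :
    Measurable[natFiltration ↥Q q] (fun ω : ↥Q → ℝ => ω r) := by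
  rw [measurable_iff_comap_le]
  exact le_iSup₂ (f := fun (t : ↥Q) (_ : t ∈ Set.Iic q) =>
      MeasurableSpace.comap (fun ω : ↥Q → ℝ => ω t) inferInstance) r h

lemma D_tendsto {Q : Set ℝ} {x : ℝ} (hx : 0 ≤ x) (hx1 : x < 1) {u : ℕ → ↥Q}
    (hu : Tendsto u atTop (rightF Q x)) (g : Dspace) :
    Tendsto (fun n => g.1 (u n)) atTop (𝓝 (g.1 x)) :=
  (g.2.1 x ⟨hx, hx1⟩).comp (seq_tendsto hu)

lemma FD_le_comap {Q : Set ℝ} (hQsub : Q ⊆ Icc (0 : ℝ) 1)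
    (hQdense : Icc (0 : ℝ) 1 ⊆ closure Q) (q : ↥Q) :
    FD q ≤ MeasurableSpace.comap (restr Q) (natFiltration ↥Q q) := by
  have key : ∀ r : ↥Q, r ≤ q →
      Measurable[MeasurableSpace.comap (restr Q) (natFiltration ↥Q q)]
        (fun g : Dspace => g.1 r) := by
    intro r hr
    exact (nat_meas hr).comp (comap_measurable (m := natFiltration ↥Q q) (restr Q))
  refine iSup₂_le fun r hr => ?_
  rw [← measurable_iff_comap_le]
  rcases hr.2.eq_or_lt with h | h
  · rw [h]; exact key q le_rfl
  · have hr1 : r < 1 := h.trans_le (hQsub q.2).2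
    obtain ⟨u, hu⟩ := exists_seq hQdense hr.1 hr1
    have hev : ∀ᶠ n in atTop, (u n : ℝ) < q :=
      ((seq_tendsto hu).mono_right nhdsWithin_le_nhds).eventually (gt_mem_nhds h)
    obtain ⟨N, hN⟩ := eventually_atTop.1 hev
    refine @measurable_of_tendsto_metrizable _ _ (MeasurableSpace.comap (restr Q) (natFiltration ↥Q q)) _ _ _ _
      (fun n g => g.1 (u (n + N))) _ (fun n => key _ (hN _ (by omega)).le) ?_
    rw [tendsto_pi_nhds]
    intro g
    exact (D_tendsto hr.1 hr1 hu g).comp (tendsto_add_atTop_nat N)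

lemma transfer {Q : Set ℝ} (hQsub : Q ⊆ Icc (0 : ℝ) 1)
    (hQdense : Icc (0 : ℝ) 1 ⊆ closure Q) {P : Measure (↥Q → ℝ)} [IsProbabilityMeasure P]
    {Pt : Measure Dspace} (hmap : Pt.map (restr Q) = P) (q : ↥Q) {F G : (↥Q → ℝ) → ℝ}
    (hF : Measurable F) (hFi : Integrable F P) (hG : Measurable G)
    (h : P[F | natFiltration ↥Q q] =ᵐ[P] G) {A : Set Dspace} (hA : MeasurableSet[FD q] A) :
    ∫ g in A, F (restr Q g) ∂Pt = ∫ g in A, G (restr Q g) ∂Pt := by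
  obtain ⟨B, hB, rfl⟩ := FD_le_comap hQsub hQdense q A hA
  have hB' : MeasurableSet B := (natFiltration ↥Q).le q B hB
  have e1 := setIntegral_map (μ := Pt) hB' (f := F) (g := restr Q)
    hF.aestronglyMeasurable (meas_restr hQsub).aemeasurable
  have e2 := setIntegral_map (μ := Pt) hB' (f := G) (g := restr Q)
    hG.aestronglyMeasurable (meas_restr hQsub).aemeasurable
  rw [← e1, ← e2, hmap, ← setIntegral_condExp ((natFiltration ↥Q).le q) hFi hB]
  exact setIntegral_congr_ae hB' (h.mono fun _ hx _ => hx)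

/-- Vitali for closed martingales. -/
lemma L1_conv {Ω : Type*} {m0 : MeasurableSpace Ω} {P : Measure Ω} [IsProbabilityMeasure P]
    {X : Ω → ℝ} (hX : Integrable X P) {G : ℕ → MeasurableSpace Ω} (hG : ∀ n, G n ≤ m0)
    {Y : ℕ → Ω → ℝ} (hY : ∀ n, P[X | G n] =ᵐ[P] Y n) {Z : Ω → ℝ}
    (hZ : ∀ᵐ ω ∂P, Tendsto (fun n => Y n ω) atTop (𝓝 (Z ω))) :
    Integrable Z P ∧ Tendsto (fun n => ∫ ω, |Y n ω - Z ω| ∂P) atTop (𝓝 0) := by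
  have hui := hX.uniformIntegrable_condExp hG
  have hui' : UniformIntegrable Y 1 P := hui.ae_eq hY
  have hYi : ∀ n, Integrable (Y n) P := fun n => integrable_condExp.congr (hY n)
  have hZm : AEStronglyMeasurable Z P :=
    aestronglyMeasurable_of_tendsto_ae atTop (fun n => (hYi n).1) hZ
  have hZi : MemLp Z 1 P := hui'.memLp_of_ae_tendsto hZ
  have ht := tendsto_Lp_finite_of_tendsto_ae (p := 1) le_rfl ENNReal.one_ne_top
    (fun n => (hYi n).1) hZi hui'.2.1 hZ
  have hZi' := memLp_one_iff_integrable.1 hZi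
  refine ⟨hZi', ?_⟩
  have : ∀ n, ∫ ω, |Y n ω - Z ω| ∂P = (eLpNorm (Y n - Z) 1 P).toReal := by
    intro n
    rw [eLpNorm_one_eq_lintegral_enorm, ← integral_norm_eq_lintegral_enorm ((hYi n).1.sub hZm)]
    rfl
  simp_rw [this]
  exact (ENNReal.tendsto_toReal ENNReal.zero_ne_top).comp ht

end Kel

namespace Kel

lemma arzela {g : ℕ → ℝ → ℝ} (hg : ∀ n, LipschitzWith 1 (g n)) {C : ℝ}
    (hC : ∀ n, |g n 0| ≤ C) : ∃ φ : ℕ → ℕ, StrictMono φ ∧ ∃ G : ℝ → ℝ, LipschitzWith 1 G ∧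
      ∀ x, Tendsto (fun n => g (φ n) x) atTop (𝓝 (G x)) := by
  have hd : ∀ n x y, |g n x - g n y| ≤ |x - y| := by
    intro n x y
    have := (hg n).dist_le_mul x y
    simpa [Real.dist_eq] using this
  have hK : IsCompact (Set.pi univ (fun q : ℚ => Icc (-(C + |(q:ℝ)|)) (C + |(q:ℝ)|))) :=
    isCompact_univ_pi fun q => isCompact_Icc
  obtain ⟨l, -, φ, hφ, hl⟩ := hK.tendsto_subseq (x := fun n (q : ℚ) => g n q) (by
    intro n q _
    have h1 := hd n q 0
    have h2 := hC n
    have h3 := abs_sub_abs_le_abs_sub (g n q) (g n 0)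
    rw [sub_zero] at h1
    exact abs_le.1 (by linarith))
  rw [tendsto_pi_nhds] at hl
  have hcau : ∀ x, CauchySeq (fun n => g (φ n) x) := by
    intro x
    rw [Metric.cauchySeq_iff]
    intro ε hε
    obtain ⟨q, hq1, hq2⟩ := exists_rat_btwn (show x < x + ε / 4 by linarith)
    have hcq := (hl q).cauchySeq
    rw [Metric.cauchySeq_iff] at hcq
    obtain ⟨N, hN⟩ := hcq (ε / 4) (by linarith)
    refine ⟨N, fun m hm n hn => ?_⟩
    have h := hN m hm n hn
    simp only [Function.comp, Real.dist_eq] at h ⊢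
    have h1 := hd (φ m) x q
    have h2 := hd (φ n) x q
    have h3 : |x - q| < ε / 4 := by rw [abs_lt]; constructor <;> linarith
    have e1 := abs_lt.1 h
    have e2 := abs_le.1 h1
    have e3 := abs_le.1 h2
    rw [abs_lt]
    constructor <;> linarith [e1.1, e1.2, e2.1, e2.2, e3.1, e3.2]
  choose G hG using fun x => cauchySeq_tendsto_of_complete (hcau x)
  refine ⟨φ, hφ, G, ?_, hG⟩
  refine LipschitzWith.of_dist_le_mul fun x y => ?_
  exact le_of_tendsto' ((hG x).dist (hG y)) fun n => (hg _).dist_le_mul x y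

lemma lip_abs {f : ℝ → ℝ} (hf : LipschitzWith 1 f) (x y : ℝ) : |f x - f y| ≤ |x - y| := by
  have := hf.dist_le_mul x y
  simpa [Real.dist_eq] using this

lemma lip_integrable {Ω : Type*} {m0 : MeasurableSpace Ω} {P : Measure Ω} [IsProbabilityMeasure P]
    {X : Ω → ℝ} (hX : Integrable X P) {f : ℝ → ℝ} (hf : LipschitzWith 1 f) :
    Integrable (fun ω => f (X ω)) P := by
  refine Integrable.mono' (g := fun ω => |f 0| + |X ω|) ((integrable_const _).add hX.abs)
    (hf.continuous.comp_aestronglyMeasurable hX.1) (Eventually.of_forall fun ω => ?_)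
  have h1 := lip_abs hf (X ω) 0
  have h3 := abs_sub_abs_le_abs_sub (f (X ω)) (f 0)
  rw [sub_zero] at h1
  rw [Real.norm_eq_abs]
  linarith

/-- If `Y n → Z` in `L¹`, then the set integrals of 1-Lipschitz images get close. -/
lemma setInt_conv {Ω : Type*} {m0 : MeasurableSpace Ω} {P : Measure Ω} [IsProbabilityMeasure P]
    {Y : ℕ → Ω → ℝ} {Z : Ω → ℝ} (hYi : ∀ n, Integrable (Y n) P) (hZ : Integrable Z P)
    (h : Tendsto (fun n => ∫ ω, |Y n ω - Z ω| ∂P) atTop (𝓝 0))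
    {g : ℕ → ℝ → ℝ} (hg : ∀ n, LipschitzWith 1 (g n)) (A : Set Ω) :
    Tendsto (fun n => ∫ ω in A, g n (Y n ω) ∂P - ∫ ω in A, g n (Z ω) ∂P) atTop (𝓝 0) := by
  refine squeeze_zero_norm (fun n => ?_) h
  have i1 := lip_integrable (hYi n) (hg n)
  have i2 := lip_integrable hZ (hg n)
  rw [← integral_sub i1.integrableOn i2.integrableOn]
  refine (norm_integral_le_integral_norm _).trans ?_
  have i3 : Integrable (fun ω => |Y n ω - Z ω|) P := ((hYi n).sub hZ).abs
  refine le_trans ?_ (setIntegral_le_integral i3 (Eventually.of_forall fun ω => abs_nonneg _)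
    (s := A))
  exact integral_mono (i1.sub i2).norm.integrableOn i3.integrableOn
    fun ω => lip_abs (hg n) _ _

section
variable {Q : Set ℝ} {P : Measure (↥Q → ℝ)} {Pt : Measure Dspace}

lemma D_conv (hQsub : Q ⊆ Icc (0 : ℝ) 1) {μ : ℝ → ProbabilityMeasure ℝ} (hPt : Pt ∈ MI μ) {x : ℝ} (hx : 0 ≤ x) (hx1 : x < 1)
    {u : ℕ → ↥Q} (hu : Tendsto u atTop (rightF Q x)) :
    Tendsto (fun n => ∫ w, |w.1 (u n) - w.1 x| ∂Pt) atTop (𝓝 0) := by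
  obtain ⟨hprob, -, hInt, hmart⟩ := hPt
  refine (L1_conv (hInt 1 ⟨zero_le_one, le_rfl⟩) (G := fun n => FDplus (u n))
    (fun n => FDplus_le (hQsub (u n).2).2)
    (Y := fun n w => w.1 (u n)) (Z := fun w => w.1 x)
    (fun n => hmart _ _ (hQsub (u n).2).1 (hQsub (u n).2).2 le_rfl) ?_).2
  exact Eventually.of_forall fun w => D_tendsto hx hx1 hu w

lemma LM_D (hQsub : Q ⊆ Icc (0 : ℝ) 1) (h1Q : (1 : ℝ) ∈ Q)
    (hQdense : Icc (0 : ℝ) 1 ⊆ closure Q) [IsProbabilityMeasure P]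
    (hPLM : LipschitzMarkovQ Q P) {μ : ℝ → ProbabilityMeasure ℝ} (hPt : Pt ∈ MI μ)
    (hmap : Pt.map (restr Q) = P) : LipschitzMarkovD Pt := by
  have hprob : IsProbabilityMeasure Pt := hPt.1
  have hInt := hPt.2.2.1
  have hmart := hPt.2.2.2
  intro s t hs hst ht f hf
  have hs1 : s < 1 := hst.trans_le ht
  have hPint : ∀ q : ↥Q, Integrable (fun ω : ↥Q → ℝ => ω q) P := by
    intro q
    rw [← hmap]
    exact (integrable_map_measure (measurable_pi_apply q).aestronglyMeasurable
      (meas_restr hQsub).aemeasurable).2 (hInt q (hQsub q.2))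
  have hqi : ∀ q : ↥Q, Integrable (fun w : Dspace => w.1 q) Pt := fun q => hInt q (hQsub q.2)
  obtain ⟨u, hu, hus, hut⟩ : ∃ u : ℕ → ↥Q, Tendsto u atTop (rightF Q s) ∧
      (∀ n, s < u n) ∧ (∀ n, (u n : ℝ) < t) := by
    obtain ⟨u, hu⟩ := exists_seq hQdense hs hs1
    have hev : ∀ᶠ n in atTop, (u n : ℝ) ∈ Ioo s t :=
      (seq_tendsto hu).eventually (Ioo_mem_nhdsGT hst)
    obtain ⟨N, hN⟩ := eventually_atTop.1 hev
    exact ⟨fun n => u (n + N), hu.comp (tendsto_add_atTop_nat N),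
      fun n => (hN _ (by omega)).1, fun n => (hN _ (by omega)).2⟩
  obtain ⟨v, hv, hvt⟩ : ∃ v : ℕ → ↥Q,
      Tendsto (fun n => ∫ w, |w.1 (v n) - w.1 t| ∂Pt) atTop (𝓝 0) ∧ ∀ n, t ≤ v n := by
    rcases ht.eq_or_lt with h | h
    · subst h
      exact ⟨fun _ => ⟨1, h1Q⟩, by simp, fun _ => le_rfl⟩
    · obtain ⟨u, hu⟩ := exists_seq hQdense (hs.trans hst.le) h
      have hev : ∀ᶠ n in atTop, (u n : ℝ) ∈ Ioi t :=
        (seq_tendsto hu).eventually self_mem_nhdsWithin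
      obtain ⟨N, hN⟩ := eventually_atTop.1 hev
      refine ⟨fun n => u (n + N), ?_, fun n => (hN _ (by omega)).le⟩
      exact (D_conv hQsub hPt (hs.trans hst.le) h hu).comp (tendsto_add_atTop_nat N)
  have huv : ∀ n, u n < v n := fun n => (hut n).trans_le (hvt n)
  choose g hg hgc using fun n => hPLM (u n) (v n) (huv n) f hf
  have heq : ∀ n, ∀ A, MeasurableSet[FDplus s] A →
      ∫ w in A, f (w.1 (v n)) ∂Pt = ∫ w in A, g n (w.1 (u n)) ∂Pt := by
    intro n A hA
    have hA' : MeasurableSet[FD (u n)] A := FDplus_le_FD (hus n) (hQsub (u n).2).2 A hA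
    exact transfer hQsub hQdense hmap (u n) (F := fun ω => f (ω (v n)))
      (G := fun ω => g n (ω (u n))) (hf.continuous.measurable.comp (measurable_pi_apply _))
      (lip_integrable (hPint _) hf) ((hg n).continuous.measurable.comp (measurable_pi_apply _))
      (hgc n) hA'
  have hmom : ∀ q : ↥Q, ∫ w, |w.1 q| ∂Pt ≤ ∫ w, |w.1 1| ∂Pt := by
    intro q
    have := integral_abs_condExp_le (m := FDplus q) (μ := Pt) (fun w : Dspace => w.1 1)
    refine le_trans (le_of_eq ?_) this
    refine integral_congr_ae ?_
    filter_upwards [hmart q 1 (hQsub q.2).1 (hQsub q.2).2 le_rfl] with w hw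
    rw [hw]
  set C1 := ∫ w, |w.1 1| ∂Pt with hC1
  have hbd : ∀ n, |g n 0| ≤ |f 0| + 2 * C1 := by
    intro n
    have e := heq n univ (@MeasurableSet.univ _ (FDplus s))
    simp only [Measure.restrict_univ] at e
    have i1 := lip_integrable (hqi (v n)) hf
    have i2 := lip_integrable (hqi (u n)) (hg n)
    have b1 : |∫ w, f (w.1 (v n)) ∂Pt - f 0| ≤ C1 := by
      have : ∫ w, f (w.1 (v n)) ∂Pt - f 0 = ∫ w, (f (w.1 (v n)) - f 0) ∂Pt := by
        rw [integral_sub i1 (integrable_const _)]; simp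
      rw [this]
      refine (abs_integral_le_integral_abs).trans (le_trans ?_ (hmom (v n)))
      refine integral_mono (i1.sub (integrable_const _)).abs (hqi _).abs fun w => ?_
      simpa using lip_abs hf (w.1 (v n)) 0
    have b2 : |∫ w, g n (w.1 (u n)) ∂Pt - g n 0| ≤ C1 := by
      have : ∫ w, g n (w.1 (u n)) ∂Pt - g n 0 = ∫ w, (g n (w.1 (u n)) - g n 0) ∂Pt := by
        rw [integral_sub i2 (integrable_const _)]; simp
      rw [this]
      refine (abs_integral_le_integral_abs).trans (le_trans ?_ (hmom (u n)))
      refine integral_mono (i2.sub (integrable_const _)).abs (hqi _).abs fun w => ?_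
      simpa using lip_abs (hg n) (w.1 (u n)) 0
    rw [e] at b1
    have c1 := abs_le.1 b1
    have c2 := abs_le.1 b2
    have c3 := neg_abs_le (f 0)
    have c4 := le_abs_self (f 0)
    rw [abs_le]
    constructor <;> linarith [c1.1, c1.2, c2.1, c2.2]
  obtain ⟨φ, hφ, G, hG, hlim⟩ := arzela hg hbd
  refine ⟨G, hG, ?_⟩
  have hsi := hInt s ⟨hs, hs1.le⟩
  have hti := hInt t ⟨hs.trans hst.le, ht⟩
  have hle := FDplus_le hs1.le
  symm
  refine ae_eq_condExp_of_forall_setIntegral_eq hle (lip_integrable hti hf)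
    (fun A _ _ => (lip_integrable hsi hG).integrableOn) ?_ ?_
  · intro A hA _
    have t1 := setInt_conv (fun n => hqi (v n)) hti hv (fun _ => hf) A
    have t2 := setInt_conv (fun n => hqi (u n)) hsi (D_conv hQsub hPt hs hs1 hu) hg A
    have t1' := t1.comp hφ.tendsto_atTop
    have t2' := t2.comp hφ.tendsto_atTop
    have t3 : Tendsto (fun n => ∫ w in A, g (φ n) (w.1 s) ∂Pt) atTop
        (𝓝 (∫ w in A, G (w.1 s) ∂Pt)) := by
      refine tendsto_integral_of_dominated_convergence
        (fun w => |f 0| + 2 * C1 + |w.1 s|)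
        (fun n => (lip_integrable hsi (hg _)).integrableOn.1)
        (((integrable_const _).add hsi.abs).integrableOn)
        (fun n => Eventually.of_forall fun w => ?_)
        (Eventually.of_forall fun w => hlim _)
      have h1 := lip_abs (hg (φ n)) (w.1 s) 0
      have h3 := abs_sub_abs_le_abs_sub (g (φ n) (w.1 s)) (g (φ n) 0)
      have h4 := hbd (φ n)
      rw [sub_zero] at h1
      rw [Real.norm_eq_abs]
      linarith
    have t4 := (t2'.sub t1').add t3
    have e4 : ∀ n, ((fun n => ∫ w in A, g n (w.1 (u n)) ∂Pt - ∫ w in A, g n (w.1 s) ∂Pt) ∘ φ) n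
        - ((fun n => ∫ w in A, f (w.1 (v n)) ∂Pt - ∫ w in A, f (w.1 t) ∂Pt) ∘ φ) n
        + ∫ w in A, g (φ n) (w.1 s) ∂Pt = ∫ w in A, f (w.1 t) ∂Pt := by
      intro n
      simp only [Function.comp]
      rw [heq (φ n) A hA]
      ring
    rw [tendsto_congr e4] at t4
    have := tendsto_nhds_unique t4 tendsto_const_nhds
    simpa using this
  · have : Measurable[FDplus s] (fun w : Dspace => G (w.1 s)) :=
      hG.continuous.measurable.comp ((meas_FD hs le_rfl).mono FD_le_FDplus le_rfl)
    exact this.stronglyMeasurable.aestronglyMeasurable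

/-- Membership in `MI` from the restriction to `Q`. -/
lemma mem_MI (hQsub : Q ⊆ Icc (0 : ℝ) 1) (h1Q : (1 : ℝ) ∈ Q)
    (hQdense : Icc (0 : ℝ) 1 ⊆ closure Q) [IsProbabilityMeasure P]
    (hPmart : Martingale (fun (t : ↥Q) (ω : ↥Q → ℝ) => ω t) (natFiltration ↥Q) P)
    {μ : ℝ → ProbabilityMeasure ℝ} [IsProbabilityMeasure Pt]
    (hmom : ∀ t ∈ Icc (0 : ℝ) 1, Integrable (fun x => |x|) (μ t : Measure ℝ))
    (hmarg : ∀ t ∈ Icc (0 : ℝ) 1, Pt.map (fun g : Dspace => g.1 t) = (μ t : Measure ℝ))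
    (hmap : Pt.map (restr Q) = P) : Pt ∈ MI μ := by
  have hInt : ∀ t ∈ Icc (0 : ℝ) 1, Integrable (fun g : Dspace => g.1 t) Pt := by
    intro t ht
    have h := hmom t ht
    rw [← hmarg t ht] at h
    have h2 := (integrable_map_measure continuous_abs.aestronglyMeasurable
      (meas_eval ht.1 ht.2).aemeasurable).1 h
    exact (integrable_norm_iff (meas_eval ht.1 ht.2).aestronglyMeasurable).1 h2
  have h1i := hInt 1 ⟨zero_le_one, le_rfl⟩
  have hPint := hPmart.integrable
  have hq : ∀ q : ↥Q, Pt[(fun g : Dspace => g.1 1) | FD q] =ᵐ[Pt] fun g : Dspace => g.1 q := by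
    intro q
    symm
    refine ae_eq_condExp_of_forall_setIntegral_eq (FD_le (hQsub q.2).2) h1i
      (fun A _ _ => (hInt q (hQsub q.2)).integrableOn) ?_ ?_
    · intro A hA _
      exact (transfer hQsub hQdense hmap q (F := fun ω => ω ⟨1, h1Q⟩) (G := fun ω => ω q)
        (measurable_pi_apply _) (hPint _) (measurable_pi_apply _)
        (hPmart.2 q ⟨1, h1Q⟩ (hQsub q.2).2) hA).symm
    · exact (meas_FD (hQsub q.2).1 le_rfl).stronglyMeasurable.aestronglyMeasurable
  have hone : ∀ s : ℝ, 0 ≤ s → s ≤ 1 →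
      Pt[(fun g : Dspace => g.1 1) | FDplus s] =ᵐ[Pt] fun g : Dspace => g.1 s := by
    intro s hs hs1
    have hmeas : Measurable[FDplus s] (fun w : Dspace => w.1 s) :=
      (meas_FD hs le_rfl).mono FD_le_FDplus le_rfl
    rcases hs1.eq_or_lt with h | h
    · subst h
      rw [condExp_of_stronglyMeasurable (FDplus_le le_rfl) hmeas.stronglyMeasurable h1i]
    · obtain ⟨u, hu⟩ := exists_seq hQdense hs h
      have hc := L1_conv h1i (G := fun n => FD (u n)) (fun n => FD_le (hQsub (u n).2).2)
        (Y := fun n w => w.1 (u n)) (Z := fun w => w.1 s) (fun n => hq (u n))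
        (Eventually.of_forall fun w => D_tendsto hs h hu w)
      symm
      refine ae_eq_condExp_of_forall_setIntegral_eq (FDplus_le hs1) h1i
        (fun A _ _ => hc.1.integrableOn) ?_ hmeas.stronglyMeasurable.aestronglyMeasurable
      intro A hA _
      have t1 := setInt_conv (fun n => hInt (u n) (hQsub (u n).2)) hc.1 hc.2
        (fun _ => LipschitzWith.id) A
      have hev : ∀ᶠ n in atTop, s < (u n : ℝ) :=
        (seq_tendsto hu).eventually self_mem_nhdsWithin
      have t2 : Tendsto (fun _ : ℕ => ∫ w in A, w.1 1 ∂Pt - ∫ w in A, w.1 s ∂Pt) atTop (𝓝 0) := by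
        refine t1.congr' ?_
        filter_upwards [hev] with n hn
        have hA' : MeasurableSet[FD (u n)] A := FDplus_le_FD hn (hQsub (u n).2).2 A hA
        have e := setIntegral_condExp (FD_le (hQsub (u n).2).2) h1i hA'
        have e2 : ∫ w in A, w.1 (u n) ∂Pt = ∫ w in A, w.1 1 ∂Pt := by
          rw [← e]
          exact integral_congr_ae (ae_restrict_of_ae (hq (u n)).symm)
        simp only [id]
        rw [e2]
      have := tendsto_nhds_unique t2 tendsto_const_nhds
      linarith
  refine ⟨inferInstance, hmarg, hInt, fun s t hs hst ht => ?_⟩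
  have h1 := condExp_condExp_of_le (μ := Pt) (f := fun g : Dspace => g.1 1)
    (FDplus_mono hst ht) (FDplus_le ht)
  have h2 := condExp_congr_ae (m := FDplus s) (hone t (hs.trans hst) ht)
  exact h2.symm.trans (h1.trans (hone s hs (hst.trans ht)))

end

end Kel

namespace Kel

/-- `n` upcrossings of `[a,b]` by `ω` along `F`, before time `x`. -/
def Alt {Q : Set ℝ} (F : Set ↥Q) (ω : ↥Q → ℝ) (a b : ℝ) : ℕ → ℝ → Prop
  | 0, _ => True
  | n + 1, x => ∃ u ∈ F, ∃ v ∈ F, u < v ∧ (v : ℝ) < x ∧ ω u < a ∧ b < ω v ∧ Alt F ω a b n u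

section
variable {Q : Set ℝ} {ω : ↥Q → ℝ} {a b : ℝ}

lemma Alt.mono_set {F F' : Set ↥Q} (h : F ⊆ F') {n : ℕ} : ∀ {x : ℝ}, Alt F ω a b n x →
    Alt F' ω a b n x := by
  induction n with
  | zero => intro x _; trivial
  | succ n ih =>
    rintro x ⟨u, hu, v, hv, h1, h2, h3, h4, h5⟩
    exact ⟨u, h hu, v, h hv, h1, h2, h3, h4, ih h5⟩

lemma Alt.mono_time {F : Set ↥Q} {n : ℕ} {x y : ℝ} (hxy : x ≤ y) (h : Alt F ω a b n x) :
    Alt F ω a b n y := by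
  cases n with
  | zero => trivial
  | succ n =>
    obtain ⟨u, hu, v, hv, h1, h2, h3, h4, h5⟩ := h
    exact ⟨u, hu, v, hv, h1, h2.trans_le hxy, h3, h4, h5⟩

lemma Alt.exists_index {F : ℕ → Set ↥Q} (hF : Monotone F) (hU : ∀ q, ∃ m, q ∈ F m) {n : ℕ} :
    ∀ {x : ℝ}, Alt univ ω a b n x → ∃ m, Alt (F m) ω a b n x := by
  induction n with
  | zero => intro x _; exact ⟨0, trivial⟩
  | succ n ih =>
    rintro x ⟨u, -, v, -, h1, h2, h3, h4, h5⟩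
    obtain ⟨m1, hm1⟩ := hU u
    obtain ⟨m2, hm2⟩ := hU v
    obtain ⟨m3, hm3⟩ := ih h5
    refine ⟨max m1 (max m2 m3), u, hF (le_max_left _ _) hm1, v,
      hF ((le_max_left _ _).trans (le_max_right _ _)) hm2, h1, h2, h3, h4,
      hm3.mono_set (hF ((le_max_right _ _).trans (le_max_right _ _)))⟩

lemma Alt.right {x : ℝ} (ha : ∃ᶠ q in rightF Q x, ω q < a) (hb : ∃ᶠ q in rightF Q x, b < ω q)
    (n : ℕ) : ∀ y, x < y → Alt univ ω a b n y := by
  have hI : ∀ y, x < y → ∀ᶠ q : ↥Q in rightF Q x, x < (q:ℝ) ∧ (q:ℝ) < y := fun y hy =>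
    Filter.tendsto_comap.eventually (Ioo_mem_nhdsGT hy)
  induction n with
  | zero => intro y _; trivial
  | succ n ih =>
    intro y hy
    obtain ⟨v, hv, hv1, hv2⟩ := (hb.and_eventually (hI y hy)).exists
    obtain ⟨u, hu, hu1, hu2⟩ := (ha.and_eventually (hI v hv1)).exists
    exact ⟨u, trivial, v, trivial, hu2, hv2, hu, hv, ih u hu1⟩

lemma Alt.left {x : ℝ} (ha : ∃ᶠ q in leftF Q x, ω q < a) (hb : ∃ᶠ q in leftF Q x, b < ω q)
    (n : ℕ) : ∃ y, y < x ∧ Alt univ ω a b n y := by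
  have hI : ∀ y, y < x → ∀ᶠ q : ↥Q in leftF Q x, y < (q:ℝ) ∧ (q:ℝ) < x := fun y hy =>
    Filter.tendsto_comap.eventually (Ioo_mem_nhdsLT hy)
  induction n with
  | zero => exact ⟨x - 1, by linarith, trivial⟩
  | succ n ih =>
    obtain ⟨y, hy, hA⟩ := ih
    obtain ⟨u, hu, hu1, hu2⟩ := (ha.and_eventually (hI y hy)).exists
    obtain ⟨v, hv, hv1, hv2⟩ := (hb.and_eventually (hI u hu2)).exists
    obtain ⟨z, hz1, hz2⟩ := exists_between hv2
    exact ⟨z, hz2, u, trivial, v, trivial, hv1, hz1, hu, hv, hA.mono_time hu1.le⟩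

/-- A path on `Q` with one-sided limits. -/
def Good (Q : Set ℝ) (ω : ↥Q → ℝ) : Prop :=
  (∀ x ∈ Ico (0 : ℝ) 1, ∃ L, Tendsto ω (rightF Q x) (𝓝 L)) ∧
  (∀ x ∈ Ioc (0 : ℝ) 1, ∃ L, Tendsto ω (leftF Q x) (𝓝 L))

lemma good_of (hbd : ∃ M : ℕ, ∀ q, |ω q| < M)
    (hup : ∀ a b : ℚ, a < b → ∃ n, ¬ Alt univ ω (a : ℝ) b n 2) : Good Q ω := by
  obtain ⟨M, hM⟩ := hbd
  have hle : ∀ l : Filter ↥Q, l.IsBoundedUnder (· ≤ ·) ω := fun l =>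
    Filter.isBoundedUnder_of ⟨M, fun q => (abs_lt.1 (hM q)).2.le⟩
  have hge : ∀ l : Filter ↥Q, l.IsBoundedUnder (· ≥ ·) ω := fun l =>
    Filter.isBoundedUnder_of ⟨-M, fun q => (abs_lt.1 (hM q)).1.le⟩
  have hd : Dense (range ((↑) : ℚ → ℝ)) := Rat.denseRange_cast
  constructor
  · intro x hx
    refine tendsto_of_no_upcrossings hd ?_ (hle _) (hge _)
    rintro _ ⟨a, rfl⟩ _ ⟨b, rfl⟩ hab ⟨h1, h2⟩
    obtain ⟨n, hn⟩ := hup a b (by exact_mod_cast hab)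
    exact hn (Alt.right h1 h2 n 2 (by linarith [hx.2]))
  · intro x hx
    refine tendsto_of_no_upcrossings hd ?_ (hle _) (hge _)
    rintro _ ⟨a, rfl⟩ _ ⟨b, rfl⟩ hab ⟨h1, h2⟩
    obtain ⟨n, hn⟩ := hup a b (by exact_mod_cast hab)
    obtain ⟨y, hy, hA⟩ := Alt.left h1 h2 n
    exact hn (hA.mono_time (by linarith [hx.2]))

/-- càdlàg regularisation of a path on `Q` -/
noncomputable def reg (h1Q : (1 : ℝ) ∈ Q) (ω : ↥Q → ℝ) (x : ℝ) : ℝ :=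
  if x < 1 then limUnder (rightF Q x) ω else ω ⟨1, h1Q⟩

lemma reg_one (h1Q : (1 : ℝ) ∈ Q) : reg h1Q ω 1 = ω ⟨1, h1Q⟩ := by simp [reg]

lemma reg_tendsto (h1Q : (1 : ℝ) ∈ Q) (hg : Good Q ω) {x : ℝ} (hx : 0 ≤ x) (hx1 : x < 1) :
    Tendsto ω (rightF Q x) (𝓝 (reg h1Q ω x)) := by
  unfold reg
  rw [if_pos hx1]
  exact tendsto_nhds_limUnder (hg.1 x ⟨hx, hx1⟩)

lemma reg_mem (h1Q : (1 : ℝ) ∈ Q) (hQdense : Icc (0 : ℝ) 1 ⊆ closure Q) (hg : Good Q ω)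
    {c d : ℝ} {K : Set ℝ} (hK : IsClosed K) (hcd : ∀ q : ↥Q, c < q → (q:ℝ) < d → ω q ∈ K)
    {x : ℝ} (hx : 0 ≤ x) (hx1 : x < 1) (hc : c < x) (hd : x < d) : reg h1Q ω x ∈ K := by
  have := rightF_neBot hQdense hx hx1
  refine hK.mem_of_tendsto (reg_tendsto h1Q hg hx hx1) ?_
  have hI : ∀ᶠ q : ↥Q in rightF Q x, x < (q:ℝ) ∧ (q:ℝ) < d :=
    Filter.tendsto_comap.eventually (Ioo_mem_nhdsGT hd)
  exact hI.mono fun q hq => hcd q (hc.trans hq.1) hq.2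

lemma reg_cadlag (h1Q : (1 : ℝ) ∈ Q) (hQdense : Icc (0 : ℝ) 1 ⊆ closure Q) (hg : Good Q ω) :
    CadlagOn01 (reg h1Q ω) := by
  constructor
  · intro x hx
    have ht := reg_tendsto h1Q hg hx.1 hx.2
    rw [Metric.tendsto_nhds] at ht ⊢
    intro ε hε
    have h1 := ht (ε / 2) (by linarith)
    rw [rightF, Filter.eventually_comap] at h1
    obtain ⟨d, hd, hsub⟩ := mem_nhdsGT_iff_exists_Ioo_subset.1 h1
    have hxd : x < min d 1 := lt_min hd hx.2
    filter_upwards [Ioo_mem_nhdsGT hxd] with z hz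
    have hmem := reg_mem h1Q hQdense hg (K := Metric.closedBall (reg h1Q ω x) (ε / 2))
      Metric.isClosed_closedBall (c := x) (d := d)
      (fun q hq1 hq2 => (hsub ⟨hq1, hq2⟩ q rfl).le) (hx.1.trans hz.1.le)
      (hz.2.trans_le (min_le_right _ _)) hz.1 (hz.2.trans_le (min_le_left _ _))
    rw [Metric.mem_closedBall] at hmem
    linarith
  · intro x hx
    obtain ⟨L, ht⟩ := hg.2 x hx
    refine ⟨L, ?_⟩
    rw [Metric.tendsto_nhds] at ht ⊢
    intro ε hε
    have h1 := ht (ε / 2) (by linarith)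
    rw [leftF, Filter.eventually_comap] at h1
    obtain ⟨d, hd, hsub⟩ := mem_nhdsLT_iff_exists_Ioo_subset.1 h1
    have hxd : max d 0 < x := max_lt hd hx.1
    filter_upwards [Ioo_mem_nhdsLT hxd] with z hz
    have hmem := reg_mem h1Q hQdense hg (K := Metric.closedBall L (ε / 2))
      Metric.isClosed_closedBall (c := d) (d := x)
      (fun q hq1 hq2 => (hsub ⟨hq1, hq2⟩ q rfl).le) ((le_max_right _ _).trans hz.1.le)
      (hz.2.trans_le hx.2) ((le_max_left _ _).trans_lt hz.1) hz.2
    rw [Metric.mem_closedBall] at hmem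
    linarith

end

section
variable {Q : Set ℝ} {P : Measure (↥Q → ℝ)} [IsProbabilityMeasure P]

/-- The discretised filtration. -/
noncomputable def discF (e : ℕ → ↥Q) (he : Monotone e) :
    Filtration ℕ (MeasurableSpace.pi : MeasurableSpace (↥Q → ℝ)) where
  seq i := natFiltration ↥Q (e i)
  mono' _ _ hij := (natFiltration ↥Q).mono (he hij)
  le' i := (natFiltration ↥Q).le (e i)

lemma disc_mart (hPmart : Martingale (fun (t : ↥Q) (ω : ↥Q → ℝ) => ω t) (natFiltration ↥Q) P)
    (e : ℕ → ↥Q) (he : Monotone e) :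
    Martingale (fun (i : ℕ) (ω : ↥Q → ℝ) => ω (e i)) (discF e he) P :=
  ⟨fun i => hPmart.1 (e i), fun i j hij => hPmart.2 (e i) (e j) (he hij)⟩

lemma mom_le (hQsub : Q ⊆ Icc (0 : ℝ) 1) (h1Q : (1 : ℝ) ∈ Q)
    (hPmart : Martingale (fun (t : ↥Q) (ω : ↥Q → ℝ) => ω t) (natFiltration ↥Q) P) (q : ↥Q) :
    ∫ ω, |ω q| ∂P ≤ ∫ ω, |ω ⟨1, h1Q⟩| ∂P := by
  have := integral_abs_condExp_le (m := natFiltration ↥Q q) (μ := P)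
    (fun ω : ↥Q → ℝ => ω ⟨1, h1Q⟩)
  refine le_trans (le_of_eq ?_) this
  refine integral_congr_ae ?_
  filter_upwards [hPmart.2 q ⟨1, h1Q⟩ (hQsub q.2).2] with w hw
  simp only [hw]

lemma alt_le_upcrossings {e : ℕ → ↥Q} (he : Monotone e) {F : Set ↥Q} {k : ℕ}
    (hF : ∀ q ∈ F, ∃ i ≤ k, e i = q) {a b : ℝ} (hab : a < b) {ω : ↥Q → ℝ} {n : ℕ} :
    ∀ {x : ℝ} {N : ℕ}, (∀ i ≤ k, (e i : ℝ) < x → i < N) → Alt F ω a b n x →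
      n ≤ upcrossingsBefore a b (fun (i : ℕ) (ω : ↥Q → ℝ) => ω (e i)) N ω := by
  induction n with
  | zero => intros; exact Nat.zero_le _
  | succ n ih =>
    rintro x N hN ⟨u, hu, v, hv, h1, h2, h3, h4, h5⟩
    obtain ⟨i, hi, rfl⟩ := hF u hu
    obtain ⟨j, hj, rfl⟩ := hF v hv
    have hij : i ≤ j := by
      by_contra hlt
      exact absurd (he (not_le.1 hlt).le) (not_le.2 h1)
    have hjN := hN j hj h2
    have hn := ih (x := (e i : ℝ)) (N := i) (fun i' _ hlt => by
      by_contra hle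
      exact absurd (he (not_lt.1 hle)) (not_le.2 hlt)) h5
    have h6 := upcrossingsBefore_lt_of_exists_upcrossing
      (f := fun (i : ℕ) (ω : ↥Q → ℝ) => ω (e i)) (ω := ω) hab (le_refl i) h3 hij h4
    have h7 := upcrossingsBefore_mono (f := fun (i : ℕ) (ω : ↥Q → ℝ) => ω (e i)) hab
      (show j + 1 ≤ N by omega) ω
    simp only at h7
    omega

lemma exists_enum (F : Finset ↥Q) (hF : F.Nonempty) : ∃ (e : ℕ → ↥Q) (k : ℕ), Monotone e ∧
    ∀ q ∈ F, ∃ i ≤ k, e i = q := by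
  obtain ⟨k, hk⟩ : ∃ k, F.card = k + 1 := ⟨F.card - 1, by have := hF.card_pos; omega⟩
  refine ⟨fun i => F.orderEmbOfFin hk ⟨min i k, by omega⟩, k, ?_, ?_⟩
  · intro i j hij
    refine (F.orderEmbOfFin hk).monotone ?_
    simp only [Fin.mk_le_mk]
    omega
  · intro q hq
    have : q ∈ Set.range (F.orderEmbOfFin hk) := by
      rw [Finset.range_orderEmbOfFin]; exact hq
    obtain ⟨i, rfl⟩ := this
    refine ⟨i, by omega, ?_⟩
    have hi : (⟨min (i : ℕ) k, by omega⟩ : Fin (k + 1)) = i :=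
      Fin.ext (show min (i : ℕ) k = i by have := i.2; omega)
    exact congrArg (F.orderEmbOfFin hk) hi

end

end Kel

namespace Kel

section
variable {Q : Set ℝ} {P : Measure (↥Q → ℝ)} [IsProbabilityMeasure P]

lemma alt_prob (hQsub : Q ⊆ Icc (0 : ℝ) 1) (h1Q : (1 : ℝ) ∈ Q)
    (hPmart : Martingale (fun (t : ↥Q) (ω : ↥Q → ℝ) => ω t) (natFiltration ↥Q) P)
    (F : Finset ↥Q) (hF : F.Nonempty) {a b : ℝ} (hab : a < b) (n : ℕ) :
    P {ω | Alt (F : Set ↥Q) ω a b (n + 1) 2} ≤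
      ENNReal.ofReal (((|a| + ∫ ω, |ω ⟨1, h1Q⟩| ∂P) / (b - a)) / (n + 1 : ℕ)) := by
  obtain ⟨e, k, he, hek⟩ := exists_enum F hF
  set f : ℕ → (↥Q → ℝ) → ℝ := fun i ω => ω (e i) with hf
  have hm : Martingale f (discF e he) P := disc_mart hPmart e he
  have hsub : {ω | Alt (F : Set ↥Q) ω a b (n + 1) 2} ⊆
      {ω | ((n + 1 : ℕ) : ℝ) ≤ (upcrossingsBefore a b f (k + 1) ω : ℝ)} := by
    intro ω hω
    have := alt_le_upcrossings he (k := k) hek hab (x := 2) (N := k + 1)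
      (fun i hi _ => by omega) hω
    exact (Nat.cast_le (α := ℝ)).2 this
  refine (measure_mono hsub).trans ?_
  have hU := hm.submartingale.mul_integral_upcrossingsBefore_le_integral_pos_part a b (k + 1)
  have hi := hm.1.integrable_upcrossingsBefore (μ := P) hab (N := k + 1)
  have hmk := mul_meas_ge_le_integral_of_nonneg (μ := P)
    (f := fun ω => (upcrossingsBefore a b f (k + 1) ω : ℝ))
    (Eventually.of_forall fun ω => Nat.cast_nonneg _) hi ((n + 1 : ℕ) : ℝ)
  have hpos : ∫ ω, (f (k + 1) ω - a)⁺ ∂P ≤ |a| + ∫ ω, |ω ⟨1, h1Q⟩| ∂P := by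
    have i1 : Integrable (f (k + 1)) P := hm.integrable _
    calc ∫ ω, (f (k + 1) ω - a)⁺ ∂P ≤ ∫ ω, (|a| + |f (k + 1) ω|) ∂P := by
          refine integral_mono (i1.sub (integrable_const a)).pos_part
            ((integrable_const _).add i1.abs) fun ω => ?_
          show max (f (k+1) ω - a) 0 ≤ _
          have := le_abs_self (f (k+1) ω)
          have := neg_abs_le a
          have := abs_nonneg a
          have := abs_nonneg (f (k+1) ω)
          exact max_le (by linarith) (by linarith)
      _ = |a| + ∫ ω, |f (k + 1) ω| ∂P := by
          rw [integral_add (integrable_const _) i1.abs]; simp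
      _ ≤ _ := add_le_add le_rfl (mom_le hQsub h1Q hPmart (e (k + 1)))
  rw [← ENNReal.ofReal_toReal (measure_ne_top P _)]
  refine ENNReal.ofReal_le_ofReal ?_
  have hn : (0:ℝ) < ((n + 1 : ℕ) : ℝ) := by positivity
  have hba : 0 < b - a := by linarith
  rw [le_div_iff₀ hn, le_div_iff₀ hba]
  have h1 : P.real {ω | ((n + 1 : ℕ) : ℝ) ≤ (upcrossingsBefore a b f (k + 1) ω : ℝ)} =
    (P {ω | ((n + 1 : ℕ) : ℝ) ≤ (upcrossingsBefore a b f (k + 1) ω : ℝ)}).toReal := rfl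
  rw [← h1]
  calc _ = (b - a) * (((n + 1 : ℕ) : ℝ) *
        P.real {ω | ((n + 1 : ℕ) : ℝ) ≤ (upcrossingsBefore a b f (k + 1) ω : ℝ)}) := by ring
    _ ≤ (b - a) * ∫ ω, (upcrossingsBefore a b f (k + 1) ω : ℝ) ∂P := by gcongr
    _ ≤ _ := hU.trans hpos

lemma bdd_prob (hQsub : Q ⊆ Icc (0 : ℝ) 1) (h1Q : (1 : ℝ) ∈ Q)
    (hPmart : Martingale (fun (t : ↥Q) (ω : ↥Q → ℝ) => ω t) (natFiltration ↥Q) P)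
    (F : Finset ↥Q) (hF : F.Nonempty) (n : ℕ) :
    P {ω | ∃ q ∈ F, ((n + 1 : ℕ) : ℝ) ≤ |ω q|} ≤
      ENNReal.ofReal ((∫ ω, |ω ⟨1, h1Q⟩| ∂P) / (n + 1 : ℕ)) := by
  obtain ⟨e, k, he, hek⟩ := exists_enum F hF
  have hm := disc_mart hPmart e he
  have hs : Submartingale (fun (i : ℕ) (ω : ↥Q → ℝ) => |ω (e i)|) (discF e he) P :=
    hm.submartingale.sup hm.neg.submartingale
  have hmax := maximal_ineq hs (fun i ω => abs_nonneg _) (ε := ((n + 1 : ℕ) : NNReal)) k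
  set S := {ω : ↥Q → ℝ | (((n + 1 : ℕ) : NNReal) : ℝ) ≤
    (Finset.range (k + 1)).sup' Finset.nonempty_range_add_one fun k => |ω (e k)|} with hS
  have hsub : {ω : ↥Q → ℝ | ∃ q ∈ F, ((n + 1 : ℕ) : ℝ) ≤ |ω q|} ⊆ S := by
    rintro ω ⟨q, hq, hle⟩
    obtain ⟨i, hi, rfl⟩ := hek q hq
    rw [hS, Set.mem_ofPred_eq]
    refine le_trans ?_ (Finset.le_sup' (fun k => |ω (e k)|) (Finset.mem_range.2 (by omega : i < k + 1)))
    simpa using hle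
  refine (measure_mono hsub).trans ?_
  have hi1 : Integrable (fun ω : ↥Q → ℝ => |ω (e k)|) P := hs.integrable k
  have hb : ∫ ω in S, |ω (e k)| ∂P ≤ ∫ ω, |ω ⟨1, h1Q⟩| ∂P :=
    (setIntegral_le_integral hi1 (Eventually.of_forall fun ω => abs_nonneg _)).trans
      (mom_le hQsub h1Q hPmart _)
  rw [ENNReal.ofReal_div_of_pos (by positivity), ENNReal.ofReal_natCast,
    ENNReal.le_div_iff_mul_le (by left; simp) (by left; simp), mul_comm]
  refine le_trans (le_of_eq ?_) (hmax.trans (ENNReal.ofReal_le_ofReal hb))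
  simp

lemma null_of_bound {Ω : Type*} {m0 : MeasurableSpace Ω} {P : Measure Ω} {S : Set Ω} {C : ℝ}
    (h : ∀ n : ℕ, P S ≤ ENNReal.ofReal (C / (n + 1 : ℕ))) : P S = 0 := by
  have h1 : Tendsto (fun n : ℕ => ENNReal.ofReal (C / (n + 1 : ℕ))) atTop (𝓝 0) := by
    have := (tendsto_const_div_atTop_nhds_zero_nat C).comp (tendsto_add_atTop_nat 1)
    simpa using ENNReal.tendsto_ofReal this
  exact le_antisymm (ge_of_tendsto' h1 h) bot_le

lemma ae_good [Countable ↥Q] (hQsub : Q ⊆ Icc (0 : ℝ) 1) (h1Q : (1 : ℝ) ∈ Q)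
    (hPmart : Martingale (fun (t : ↥Q) (ω : ↥Q → ℝ) => ω t) (natFiltration ↥Q) P) :
    ∀ᵐ ω ∂P, Good Q ω := by
  have : Nonempty ↥Q := ⟨⟨1, h1Q⟩⟩
  obtain ⟨en, hen⟩ := exists_surjective_nat ↥Q
  set F : ℕ → Finset ↥Q := fun m => (Finset.range (m + 1)).image en with hFdef
  have hFn : ∀ m, (F m).Nonempty := fun m => (Finset.nonempty_range_add_one).image _
  have hFm : Monotone fun m => (F m : Set ↥Q) := by
    intro i j hij
    exact Finset.coe_subset.2 (Finset.image_subset_image (Finset.range_mono (by omega)))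
  have hFu : ∀ q, ∃ m, q ∈ (F m : Set ↥Q) := by
    intro q
    obtain ⟨m, rfl⟩ := hen q
    exact ⟨m, Finset.mem_coe.2 (Finset.mem_image_of_mem _ (Finset.mem_range.2 (by omega)))⟩
  have hup : ∀ᵐ ω ∂P, ∀ a b : ℚ, a < b → ∃ n, ¬ Alt univ ω (a : ℝ) b n 2 := by
    rw [ae_all_iff]; intro a
    rw [ae_all_iff]; intro b
    by_cases hab : a < b
    swap
    · exact Eventually.of_forall fun ω h => absurd h hab
    have hab' : (a : ℝ) < b := by exact_mod_cast hab
    rw [ae_iff]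
    refine null_of_bound (C := (|(a:ℝ)| + ∫ ω, |ω ⟨1, h1Q⟩| ∂P) / (b - a)) fun n => ?_
    have hsub : {ω : ↥Q → ℝ | ¬ (a < b → ∃ n, ¬ Alt univ ω (a : ℝ) b n 2)} ⊆
        ⋃ m, {ω | Alt (F m : Set ↥Q) ω a b (n + 1) 2} := by
      intro ω hω
      simp only [Set.mem_ofPred_eq, not_forall, not_exists, not_not] at hω
      obtain ⟨_, hω⟩ := hω
      exact Set.mem_iUnion.2 (Alt.exists_index hFm hFu (hω (n + 1)))
    refine (measure_mono hsub).trans ?_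
    have hmono : Monotone fun m => {ω : ↥Q → ℝ | Alt (F m : Set ↥Q) ω (a : ℝ) b (n + 1) 2} :=
      fun i j hij ω (h : Alt _ _ _ _ _ _) => h.mono_set (hFm hij)
    rw [hmono.measure_iUnion]
    exact iSup_le fun m => alt_prob hQsub h1Q hPmart (F m) (hFn m) hab' n
  have hbd : ∀ᵐ ω ∂P, ∃ M : ℕ, ∀ q, |ω q| < (M : ℝ) := by
    rw [ae_iff]
    refine null_of_bound (C := ∫ ω, |ω ⟨1, h1Q⟩| ∂P) fun n => ?_
    have hsub : {ω : ↥Q → ℝ | ¬ ∃ M : ℕ, ∀ q, |ω q| < (M : ℝ)} ⊆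
        ⋃ m, {ω | ∃ q ∈ F m, ((n + 1 : ℕ) : ℝ) ≤ |ω q|} := by
      intro ω hω
      simp only [Set.mem_ofPred_eq, not_forall, not_exists, not_lt] at hω
      obtain ⟨q, hq⟩ := hω (n + 1)
      obtain ⟨m, hm⟩ := hFu q
      exact Set.mem_iUnion.2 ⟨m, q, hm, hq⟩
    refine (measure_mono hsub).trans ?_
    rw [Monotone.measure_iUnion (by
      rintro i j hij ω ⟨q, hq, h⟩
      exact ⟨q, hFm hij hq, h⟩)]
    exact iSup_le fun m => bdd_prob hQsub h1Q hPmart (F m) (hFn m) n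
  filter_upwards [hup, hbd] with ω h1 h2
  exact good_of h2 h1

/-- A martingale pair with equal laws is constant. -/
lemma eq_of_law {Ω : Type*} {m0 : MeasurableSpace Ω} {P : Measure Ω} [IsProbabilityMeasure P]
    {X Y : Ω → ℝ} (hXm : Measurable X) (hYm : AEMeasurable Y P) (hX : Integrable X P)
    (hY : Integrable Y P) (hlaw : P.map X = P.map Y)
    (hmart : ∀ c : ℝ, ∫ ω in {ω | c < X ω}, Y ω ∂P = ∫ ω in {ω | c < X ω}, X ω ∂P) :
    X =ᵐ[P] Y := by
  have key : ∀ c : ℚ, ∀ᵐ ω ∂P, X ω ≤ c → Y ω ≤ c := by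
    intro c
    set A := {ω | (c : ℝ) < X ω} with hA
    have hAm : MeasurableSet A := measurableSet_lt measurable_const hXm
    have iX : Integrable (fun ω => max (X ω - c) 0) P := (hX.sub (integrable_const _)).pos_part
    have iY : Integrable (fun ω => max (Y ω - c) 0) P := (hY.sub (integrable_const _)).pos_part
    have hmx : Measurable (fun x : ℝ => max (x - c) 0) := by fun_prop
    have e1 : ∫ ω, max (X ω - c) 0 ∂P = ∫ ω, max (Y ω - c) 0 ∂P := by
      have h1 := integral_map (μ := P) hXm.aemeasurable (f := fun x : ℝ => max (x - c) 0)
        hmx.aestronglyMeasurable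
      have h2 := integral_map (μ := P) hYm (f := fun x : ℝ => max (x - c) 0)
        hmx.aestronglyMeasurable
      rw [← h1, ← h2, hlaw]
    have e2 : ∫ ω, max (X ω - c) 0 ∂P = ∫ ω in A, (X ω - c) ∂P := by
      rw [← integral_indicator hAm]
      refine integral_congr_ae (Eventually.of_forall fun ω => ?_)
      by_cases h : ω ∈ A
      · simp only [Set.indicator_of_mem h]
        exact max_eq_left (by have : (c:ℝ) < X ω := h; linarith)
      · simp only [Set.indicator_of_notMem h]
        exact max_eq_right (by have : ¬ (c:ℝ) < X ω := h; linarith)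
    have e3 : ∫ ω in A, (X ω - c) ∂P = ∫ ω in A, (Y ω - c) ∂P := by
      rw [integral_sub hX.integrableOn (integrable_const _),
        integral_sub hY.integrableOn (integrable_const _), hmart c]
    have e4 : ∫ ω in A, (Y ω - c) ∂P ≤ ∫ ω in A, max (Y ω - c) 0 ∂P :=
      integral_mono (hY.sub (integrable_const _)).integrableOn iY.integrableOn
        fun ω => le_max_left _ _
    have e5 := integral_add_compl hAm iY
    have e6 : 0 ≤ ∫ ω in Aᶜ, max (Y ω - c) 0 ∂P := integral_nonneg fun ω => le_max_right _ _
    have e7 : ∫ ω in Aᶜ, max (Y ω - c) 0 ∂P = 0 := by linarith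
    replace e7 := (integral_eq_zero_iff_of_nonneg (f := fun ω => max (Y ω - c) 0)
      (fun ω => le_max_right _ _) iY.integrableOn).1 e7
    have e8 := (ae_restrict_iff' hAm.compl).1 e7
    filter_upwards [e8] with ω h hle
    have h9 := h (by simpa [hA] using hle)
    have h10 : max (Y ω - c) 0 = 0 := h9
    have := le_max_left (Y ω - c) 0
    linarith
  have hYX : ∀ᵐ ω ∂P, Y ω ≤ X ω := by
    filter_upwards [ae_all_iff.2 key] with ω h
    by_contra hlt
    obtain ⟨c, hc1, hc2⟩ := exists_rat_btwn (not_le.1 hlt)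
    linarith [h c hc1.le]
  have hInt : ∫ ω, X ω ∂P = ∫ ω, Y ω ∂P := by
    have h1 := integral_map (μ := P) hXm.aemeasurable (f := fun x : ℝ => x)
      aestronglyMeasurable_id
    have h2 := integral_map (μ := P) hYm (f := fun x : ℝ => x) aestronglyMeasurable_id
    rw [← h1, ← h2, hlaw]
  have h0 : ∫ ω, (X ω - Y ω) ∂P = 0 := by rw [integral_sub hX hY, hInt, sub_self]
  replace h0 := (integral_eq_zero_iff_of_nonneg_ae (f := fun ω => X ω - Y ω)
    (hYX.mono fun ω h => by simpa using h) (hX.sub hY)).1 h0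
  filter_upwards [h0] with ω h
  have : X ω - Y ω = 0 := h
  linarith

end

end Kel

namespace Kel

lemma zero_cadlag : CadlagOn01 (fun _ => 0) :=
  ⟨fun _ _ => tendsto_const_nhds, fun _ _ => ⟨0, tendsto_const_nhds⟩⟩

lemma measurable_D {Ω : Type*} [MeasurableSpace Ω] {Φ : Ω → Dspace}
    (h : ∀ t ∈ Icc (0 : ℝ) 1, Measurable (fun ω => (Φ ω).1 t)) : Measurable Φ := by
  rw [measurable_iff_comap_le]
  change MeasurableSpace.comap Φ (⨆ t ∈ Icc (0 : ℝ) 1,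
    MeasurableSpace.comap (fun g : Dspace => g.1 t) inferInstance) ≤ _
  rw [MeasurableSpace.comap_iSup]
  refine iSup_le fun t => ?_
  rw [MeasurableSpace.comap_iSup]
  refine iSup_le fun ht => ?_
  rw [MeasurableSpace.comap_comp]
  exact measurable_iff_comap_le.1 (h t ht)

lemma exists_D {Q : Set ℝ} [Countable ↥Q] (hQsub : Q ⊆ Icc (0 : ℝ) 1) (h1Q : (1 : ℝ) ∈ Q)
    (hQdense : Icc (0 : ℝ) 1 ⊆ closure Q)
    {μ : ℝ → ProbabilityMeasure ℝ}
    (hrc : ∀ t ∈ Ico (0 : ℝ) 1, Tendsto μ (𝓝[>] t) (𝓝 (μ t)))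
    {P : Measure (↥Q → ℝ)} [IsProbabilityMeasure P]
    (hPmart : Martingale (fun (t : ↥Q) (ω : ↥Q → ℝ) => ω t) (natFiltration ↥Q) P)
    (hPmarg : ∀ t : ↥Q, P.map (fun ω => ω t) = (μ (t : ℝ) : Measure ℝ)) :
    ∃ Pt : Measure Dspace, IsProbabilityMeasure Pt ∧
      (∀ t ∈ Icc (0 : ℝ) 1, Pt.map (fun g : Dspace => g.1 t) = (μ t : Measure ℝ)) ∧
      Pt.map (restr Q) = P := by
  classical
  have hgood := ae_good hQsub h1Q hPmart
  set N := toMeasurable P {ω | ¬ Good Q ω} with hN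
  have hNm : MeasurableSet N := measurableSet_toMeasurable _ _
  have hN0 : P N = 0 := by rw [hN, measure_toMeasurable]; exact hgood
  have hNg : ∀ ω, ω ∉ N → Good Q ω := by
    intro ω hω
    by_contra h
    exact hω (subset_toMeasurable _ _ h)
  have hNae : ∀ᵐ ω ∂P, ω ∉ N := measure_eq_zero_iff_ae_notMem.1 hN0
  let Φ : (↥Q → ℝ) → Dspace := fun ω =>
    if h : ω ∈ N then ⟨fun _ => 0, zero_cadlag⟩
    else ⟨reg h1Q ω, reg_cadlag h1Q hQdense (hNg ω h)⟩
  have hΦ0 : ∀ ω, ω ∈ N → ∀ t, (Φ ω).1 t = 0 := by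
    intro ω h t
    have e : Φ ω = ⟨fun _ => 0, zero_cadlag⟩ := dif_pos h
    rw [e]
  have hΦ1 : ∀ ω, ω ∉ N → ∀ t, (Φ ω).1 t = reg h1Q ω t := by
    intro ω h t
    have e : Φ ω = ⟨reg h1Q ω, reg_cadlag h1Q hQdense (hNg ω h)⟩ := dif_neg h
    rw [e]
  have hlim : ∀ t, 0 ≤ t → t < 1 → ∀ u : ℕ → ↥Q, Tendsto u atTop (rightF Q t) → ∀ ω, ω ∉ N →
      Tendsto (fun n => ω (u n)) atTop (𝓝 ((Φ ω).1 t)) := by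
    intro t ht ht1 u hu ω hω
    rw [hΦ1 ω hω t]
    exact (reg_tendsto h1Q (hNg ω hω) ht ht1).comp hu
  have hone : ∀ ω, ω ∉ N → (Φ ω).1 1 = ω ⟨1, h1Q⟩ := by
    intro ω hω
    rw [hΦ1 ω hω, reg_one]
  have hmeas : ∀ t ∈ Icc (0 : ℝ) 1, Measurable (fun ω => (Φ ω).1 t) := by
    intro t ht
    rcases ht.2.eq_or_lt with h | h
    · subst h
      have : (fun ω => (Φ ω).1 1) = Nᶜ.indicator (fun ω => ω ⟨1, h1Q⟩) := by
        ext ω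
        by_cases hω : ω ∈ N
        · rw [hΦ0 ω hω, Set.indicator_of_notMem (by simpa using hω)]
        · rw [hone ω hω, Set.indicator_of_mem (by simpa using hω)]
      rw [this]
      exact (measurable_pi_apply _).indicator hNm.compl
    · obtain ⟨u, hu⟩ := exists_seq hQdense ht.1 h
      refine measurable_of_tendsto_metrizable
        (f := fun n => Nᶜ.indicator (fun ω : ↥Q → ℝ => ω (u n)))
        (fun n => (measurable_pi_apply _).indicator hNm.compl) ?_
      rw [tendsto_pi_nhds]
      intro ω
      by_cases hω : ω ∈ N
      · have hc : ω ∉ Nᶜ := by simpa using hω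
        simp only [Set.indicator_of_notMem hc, hΦ0 ω hω]
        exact tendsto_const_nhds
      · have hc : ω ∈ Nᶜ := hω
        simp only [Set.indicator_of_mem hc]
        exact hlim t ht.1 h u hu ω hω
  have hΦm : Measurable Φ := measurable_D hmeas
  have hlaw : ∀ t ∈ Icc (0 : ℝ) 1, P.map (fun ω => (Φ ω).1 t) = (μ t : Measure ℝ) := by
    intro t ht
    rcases ht.2.eq_or_lt with h | h
    · subst h
      rw [← hPmarg ⟨1, h1Q⟩]
      exact Measure.map_congr (hNae.mono fun ω hω => hone ω hω)
    · obtain ⟨u, hu⟩ := exists_seq hQdense ht.1 h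
      have : IsProbabilityMeasure (P.map (fun ω => (Φ ω).1 t)) :=
        Measure.isProbabilityMeasure_map (hmeas t ht).aemeasurable
      refine ext_of_forall_integral_eq_of_IsFiniteMeasure fun f => ?_
      have t1 := (ProbabilityMeasure.tendsto_iff_forall_integral_tendsto.1
        ((hrc t ⟨ht.1, h⟩).comp (seq_tendsto hu))) f
      have t2 : Tendsto (fun n => ∫ ω, f (ω (u n)) ∂P) atTop
          (𝓝 (∫ ω, f ((Φ ω).1 t) ∂P)) := by
        refine tendsto_integral_of_dominated_convergence (fun _ => ‖f‖)
          (fun n => (f.continuous.measurable.comp (measurable_pi_apply _)).aestronglyMeasurable)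
          (integrable_const _) (fun n => Eventually.of_forall fun ω => f.norm_coe_le_norm _) ?_
        filter_upwards [hNae] with ω hω
        exact (f.continuous.tendsto _).comp (hlim t ht.1 h u hu ω hω)
      rw [integral_map (hmeas t ht).aemeasurable f.continuous.aestronglyMeasurable]
      refine tendsto_nhds_unique t2 (t1.congr fun n => ?_)
      simp only [Function.comp]
      rw [← hPmarg (u n), integral_map (measurable_pi_apply _).aemeasurable
        f.continuous.aestronglyMeasurable]
  have hrestr : ∀ q : ↥Q, (fun ω => ω q) =ᵐ[P] fun ω => (Φ ω).1 q := by
    intro q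
    have hq := hQsub q.2
    rcases hq.2.eq_or_lt with h | h
    · filter_upwards [hNae] with ω hω
      have hq1 : q = ⟨1, h1Q⟩ := Subtype.ext h
      rw [hq1]
      exact (hone ω hω).symm
    · obtain ⟨u, hu⟩ := exists_seq hQdense hq.1 h
      have hc := L1_conv (hPmart.integrable ⟨1, h1Q⟩) (G := fun n => natFiltration ↥Q (u n))
        (fun n => (natFiltration ↥Q).le _) (Y := fun n ω => ω (u n)) (Z := fun ω => (Φ ω).1 q)
        (fun n => hPmart.2 (u n) ⟨1, h1Q⟩ (hQsub (u n).2).2)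
        (hNae.mono fun ω hω => hlim q hq.1 h u hu ω hω)
      refine eq_of_law (measurable_pi_apply q) (hmeas q hq).aemeasurable (hPmart.integrable q)
        hc.1 ((hPmarg q).trans (hlaw q hq).symm) fun c => ?_
      have hA : MeasurableSet[natFiltration ↥Q q] {ω : ↥Q → ℝ | c < ω q} :=
        nat_meas (le_refl q) measurableSet_Ioi
      have t1 := setInt_conv (fun n => hPmart.integrable (u n)) hc.1 hc.2
        (fun _ => LipschitzWith.id) {ω : ↥Q → ℝ | c < ω q}
      have hev : ∀ᶠ n in atTop, (q : ℝ) < (u n : ℝ) :=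
        (seq_tendsto hu).eventually self_mem_nhdsWithin
      have t2 : Tendsto (fun _ : ℕ => ∫ ω in {ω : ↥Q → ℝ | c < ω q}, ω q ∂P -
          ∫ ω in {ω : ↥Q → ℝ | c < ω q}, (Φ ω).1 q ∂P) atTop (𝓝 0) := by
        refine t1.congr' ?_
        filter_upwards [hev] with n hn
        have e := hPmart.setIntegral_eq (i := q) (j := u n) hn.le hA
        simp only [id]
        rw [e]
      have := tendsto_nhds_unique t2 tendsto_const_nhds
      linarith
  refine ⟨P.map Φ, Measure.isProbabilityMeasure_map hΦm.aemeasurable, ?_, ?_⟩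
  · intro t ht
    rw [Measure.map_map (meas_eval ht.1 ht.2) hΦm]
    exact hlaw t ht
  · rw [Measure.map_map (meas_restr hQsub) hΦm]
    have : (restr Q ∘ Φ) =ᵐ[P] id := by
      filter_upwards [ae_all_iff.2 hrestr] with ω h
      funext q
      exact (h q).symm
    rw [Measure.map_congr this, Measure.map_id]

end Kel

/-- Kellerer's theorem: for a right-continuous peacock `(μ_t)_{t∈[0,1]}`,
`Q ∋ 1` countable dense in `[0,1]` and `P` a Lipschitz-Markov martingale measure on `ℝ^Q`
with marginals `(μ_t)_{t∈Q}`, the corresponding càdlàg martingale measure `P̃` on the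
Skorokhod space is Lipschitz-Markov w.r.t. `F⁺`; in particular there exists a (strong)
Markov càdlàg martingale with marginals `(μ_t)_{t∈[0,1]}`. -/
theorem kellerer
    (Q : Set ℝ) [Countable ↥Q] (hQsub : Q ⊆ Icc (0 : ℝ) 1) (h1Q : (1 : ℝ) ∈ Q)
    (hQdense : Icc (0 : ℝ) 1 ⊆ closure Q)
    (μ : ℝ → ProbabilityMeasure ℝ)
    (hmom : ∀ t ∈ Icc (0 : ℝ) 1, Integrable (fun x => |x|) (μ t : Measure ℝ))
    (hpeacock : ∀ s t : ℝ, 0 ≤ s → s ≤ t → t ≤ 1 →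
      ConvexOrder (μ s : Measure ℝ) (μ t : Measure ℝ))
    (hrc : ∀ t ∈ Ico (0 : ℝ) 1, Tendsto μ (𝓝[>] t) (𝓝 (μ t)))
    (P : Measure (↥Q → ℝ)) [IsProbabilityMeasure P]
    (hPmart : Martingale (fun (t : ↥Q) (ω : ↥Q → ℝ) => ω t) (natFiltration ↥Q) P)
    (hPmarg : ∀ t : ↥Q, P.map (fun ω => ω t) = (μ (t : ℝ) : Measure ℝ))
    (hPLM : LipschitzMarkovQ Q P) :
    (∀ Pt : Measure Dspace, Pt ∈ MI μ →
      Pt.map (fun g (q : ↥Q) => g.1 q) = P → LipschitzMarkovD Pt) ∧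
    (∃ Pt : Measure Dspace, Pt ∈ MI μ ∧
      Pt.map (fun g (q : ↥Q) => g.1 q) = P ∧ LipschitzMarkovD Pt) := by
  have hfirst : ∀ Pt : Measure Dspace, Pt ∈ MI μ →
      Pt.map (fun g (q : ↥Q) => g.1 q) = P → LipschitzMarkovD Pt := fun Pt hPt hmap =>
    Kel.LM_D hQsub h1Q hQdense hPLM hPt hmap
  refine ⟨hfirst, ?_⟩
  obtain ⟨Pt, hprob, hmarg, hmap⟩ := Kel.exists_D hQsub h1Q hQdense hrc hPmart hPmarg
  have hMI : Pt ∈ MI μ := Kel.mem_MI hQsub h1Q hQdense hPmart hmom hmarg hmap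
  exact ⟨Pt, hMI, hmap, hfirst Pt hMI hmap⟩
end
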